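/- arXiv:1309.6485 — 2 statements merged into one kernel-verified Lean document; each statement's English description precedes it below -/
import Mathlib

section
/- Let K = T(B_2^{2n}) be an origin-symmetric ellipsoid in ℝ^{2n} (the image of the unit Euclidean ball under an invertible linear map T), and define the star body K_c by ‖x‖_{K_c}^{−2} = (1/(2π)) ∫_0^{2π} ‖R_θ x‖_K^{−2} dθ for x ≠ 0. Then K_c is a complex intersection body: there exists a finite Borel R_θ-invariant measure μ on S^{2n−1} such that for every continuous R_θ-invariant function f on S^{2n−1}, ∫_{S^{2n−1}} ‖x‖_{K_c}^{−2} f(x) dσ(x) = ∫_{S^{2n−1}} (∫_{S^{2n−1}∩H_ξ} f dH^{2n−3}) dμ(ξ). -/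
open MeasureTheory Metric Pointwise

noncomputable section

variable {n : ℕ}

instance : InnerProductSpace ℝ (EuclideanSpace ℂ (Fin n)) := InnerProductSpace.complexToReal
instance : MeasurableSpace (EuclideanSpace ℂ (Fin n)) := borel _
instance : BorelSpace (EuclideanSpace ℂ (Fin n)) := ⟨rfl⟩

/-- The coordinate-wise rotation `R_θ` on `ℂ^n ≅ ℝ^{2n}`: multiplication by `e^{iθ}`. -/
def rot (θ : ℝ) (x : EuclideanSpace ℂ (Fin n)) : EuclideanSpace ℂ (Fin n) :=
  Complex.exp (θ * Complex.I) • x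

/-- A set `A ⊆ ℂ^n ≅ ℝ^{2n}` is `R_θ`-invariant if it is preserved by all coordinate-wise
rotations. -/
def RotInvariantSet (A : Set (EuclideanSpace ℂ (Fin n))) : Prop :=
  ∀ θ : ℝ, rot θ '' A = A

/-- A function on `ℂ^n ≅ ℝ^{2n}` is `R_θ`-invariant if it is preserved by all coordinate-wise
rotations. -/
def RotInvariantFun (f : EuclideanSpace ℂ (Fin n) → ℝ) : Prop :=
  ∀ (θ : ℝ) (x : EuclideanSpace ℂ (Fin n)), f (rot θ x) = f x

/-- The complex hyperplane `H_ξ = {z : Σ_k z_k conj(ξ_k) = 0}` perpendicular to `ξ`, viewed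
as a `(2n−2)`-dimensional subspace of `ℝ^{2n} ≅ ℂ^n`. -/
def complexHyperplane (ξ : EuclideanSpace ℂ (Fin n)) : Set (EuclideanSpace ℂ (Fin n)) :=
  (((Submodule.span ℂ {ξ})ᗮ : Submodule ℂ (EuclideanSpace ℂ (Fin n))) :
    Set (EuclideanSpace ℂ (Fin n)))

/-- A star body: a compact set with the origin in its interior such that every ray from the
origin meets the boundary exactly once, and whose Minkowski functional (gauge) is continuous. -/
def IsStarBody {V : Type*} [NormedAddCommGroup V] [NormedSpace ℝ V] (K : Set V) : Prop :=
  IsCompact K ∧ 0 ∈ interior K ∧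
    (∀ x : V, x ≠ 0 → ∃! t : ℝ, 0 < t ∧ t • x ∈ frontier K) ∧
    Continuous (gauge K)

/-- `μ` is a defining measure for the complex intersection body `K`: a finite Borel
`R_θ`-invariant measure on `S^{2n−1}` such that for every continuous `R_θ`-invariant `f`,
`∫_{S^{2n−1}} ‖x‖_K^{−2} f(x) dσ(x) = ∫_{S^{2n−1}} (∫_{S^{2n−1}∩H_ξ} f dH^{2n−3}) dμ(ξ)`. -/
def IsComplexIntersectionMeasure (K : Set (EuclideanSpace ℂ (Fin n)))
    (μ : Measure (EuclideanSpace ℂ (Fin n))) : Prop :=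
  IsFiniteMeasure μ ∧ μ (sphere (0 : EuclideanSpace ℂ (Fin n)) 1)ᶜ = 0 ∧
    (∀ θ : ℝ, μ.map (rot θ) = μ) ∧
    ∀ f : EuclideanSpace ℂ (Fin n) → ℝ, Continuous f → RotInvariantFun f →
      ∫ x in sphere (0 : EuclideanSpace ℂ (Fin n)) 1,
          ((gauge K x) ^ 2)⁻¹ * f x ∂μH[(2 * (n : ℝ) - 1)] =
        ∫ ξ in sphere (0 : EuclideanSpace ℂ (Fin n)) 1,
          (∫ x in sphere (0 : EuclideanSpace ℂ (Fin n)) 1 ∩ complexHyperplane ξ,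
            f x ∂μH[(2 * (n : ℝ) - 3)]) ∂μ

/-- `K` is a complex intersection body: an origin-symmetric `R_θ`-invariant star body in
`ℝ^{2n} ≅ ℂ^n` admitting a defining measure. -/
def IsComplexIntersectionBody (K : Set (EuclideanSpace ℂ (Fin n))) : Prop :=
  IsStarBody K ∧ K = -K ∧ RotInvariantSet K ∧
    ∃ μ : Measure (EuclideanSpace ℂ (Fin n)), IsComplexIntersectionMeasure K μ

/-- `d_n = |B_2^{2n}|^((n-1)/n) / |B_2^{2n-2}|`, where `B_2^m` is the unit Euclidean ball
in `ℝ^m`. -/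
def complexBallVolRatio (n : ℕ) : ℝ :=
  (volume (closedBall (0 : EuclideanSpace ℝ (Fin (2 * n))) 1)).toReal ^ (((n : ℝ) - 1) / n) /
    (volume (closedBall (0 : EuclideanSpace ℝ (Fin (2 * n - 2))) 1)).toReal

section LinearAlgebra

open Module

theorem exists_comp_linearIsometry_eq {E F : Type*} [NormedAddCommGroup E] [InnerProductSpace ℝ E]
    [FiniteDimensional ℝ E] [NormedAddCommGroup F] [InnerProductSpace ℝ F]
    (C : E →ₗ[ℝ] F) (hC : Function.Injective C) :
    ∃ (M : E ≃ₗ[ℝ] E) (ι : E →ₗᵢ[ℝ] F), ∀ x, C x = ι (M x) := by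
  have hrank : finrank ℝ C.range = finrank ℝ E := LinearMap.finrank_range_of_inj hC
  let i : E ≃ₗᵢ[ℝ] C.range :=
    (stdOrthonormalBasis ℝ E).repr.trans
      (((stdOrthonormalBasis ℝ C.range).reindex (finCongr hrank)).repr.symm)
  let c : E ≃ₗ[ℝ] C.range := LinearEquiv.ofInjective C hC
  refine ⟨c.trans i.symm.toLinearEquiv, C.range.subtypeₗᵢ.comp i.toLinearIsometry, fun x => ?_⟩
  simp [c]

theorem LinearMap.det_prod_shear {E F : Type*} [AddCommGroup E] [Module ℝ E]
    [FiniteDimensional ℝ E] [AddCommGroup F] [Module ℝ F] [FiniteDimensional ℝ F]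
    (f : F →ₗ[ℝ] E) (D : F →ₗ[ℝ] F) :
    LinearMap.det ((LinearMap.fst ℝ E F + f ∘ₗ LinearMap.snd ℝ E F).prod
      (D ∘ₗ LinearMap.snd ℝ E F)) = LinearMap.det D := by
  let s : (F →ₗ[ℝ] E) → (E × F →ₗ[ℝ] E × F) := fun f =>
    (LinearMap.fst ℝ E F + f ∘ₗ LinearMap.snd ℝ E F).prod (LinearMap.snd ℝ E F)
  let c : (E × F) ≃ₗ[ℝ] (E × F) :=
    (LinearEquiv.smulOfNeZero ℝ E (2 : ℝ) two_ne_zero).prodCongr (LinearEquiv.refl ℝ F)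
  have hsq : (s f ∘ₗ s f) ∘ₗ c.toLinearMap = c.toLinearMap ∘ₗ s f := by
    refine LinearMap.ext fun p => Prod.ext ?_ ?_
    · simp [s, c, two_smul]
      abel
    · simp [s, c]
  have hinv : s (-f) ∘ₗ s f = LinearMap.id := by
    refine LinearMap.ext fun p => ?_
    refine Prod.ext ?_ ?_ <;> simp [s]
  have h1 : LinearMap.det (s f) * LinearMap.det (s f) = LinearMap.det (s f) := by
    have := congrArg LinearMap.det hsq
    rw [LinearMap.det_comp, LinearMap.det_comp, LinearMap.det_comp, mul_comm] at this
    exact mul_left_cancel₀ (LinearEquiv.isUnit_det' c).ne_zero this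
  have h2 : LinearMap.det (s f) ≠ 0 := by
    intro h0
    have := congrArg LinearMap.det hinv
    simp [LinearMap.det_comp, h0] at this
  have h3 : LinearMap.det (s f) = 1 := mul_left_cancel₀ h2 (by rw [h1, mul_one])
  have : (LinearMap.fst ℝ E F + f ∘ₗ LinearMap.snd ℝ E F).prod (D ∘ₗ LinearMap.snd ℝ E F) =
      LinearMap.prodMap LinearMap.id D ∘ₗ s f := by
    refine LinearMap.ext fun p => ?_
    refine Prod.ext ?_ ?_ <;> simp [s]
  rw [this, LinearMap.det_comp, h3, LinearMap.det_prodMap, LinearMap.det_id, one_mul, mul_one]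

/-- For orthogonal complementary subspaces `j₁ E`, `j₂ F`, the volume distortion of the adjoint of
`T` on the one is that of `T⁻¹` on the other, times the volume distortion of `T`. -/
theorem abs_det_eq_of_orthogonal {E F V : Type*}
    [NormedAddCommGroup E] [InnerProductSpace ℝ E] [FiniteDimensional ℝ E]
    [NormedAddCommGroup F] [InnerProductSpace ℝ F] [FiniteDimensional ℝ F]
    [NormedAddCommGroup V] [InnerProductSpace ℝ V] [FiniteDimensional ℝ V]
    (j₁ : E →ₗᵢ[ℝ] V) (j₂ : F →ₗᵢ[ℝ] V) (hj : ∀ x y, inner ℝ (j₁ x) (j₂ y) = 0)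
    (hrank : finrank ℝ E + finrank ℝ F = finrank ℝ V) (T : V ≃ₗ[ℝ] V)
    (N : E ≃ₗ[ℝ] E) (ι₁ : E →ₗᵢ[ℝ] V) (hN : ∀ x, T.symm (j₁ x) = ι₁ (N x))
    (M : F ≃ₗ[ℝ] F) (ι₂ : F →ₗᵢ[ℝ] V)
    (hM : ∀ y, LinearMap.adjoint T.toLinearMap (j₂ y) = ι₂ (M y)) :
    |LinearMap.det M.toLinearMap| =
      |LinearMap.det T.toLinearMap| * |LinearMap.det N.toLinearMap| := by
  have norm_coprod : ∀ (i₁ : E →ₗᵢ[ℝ] V) (i₂ : F →ₗᵢ[ℝ] V),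
      (∀ x y, inner ℝ (i₁ x) (i₂ y) = 0) → ∀ p : E × F,
      ‖i₁.toLinearMap.coprod i₂.toLinearMap p‖ * ‖i₁.toLinearMap.coprod i₂.toLinearMap p‖ =
        ‖p.1‖ * ‖p.1‖ + ‖p.2‖ * ‖p.2‖ := by
    intro i₁ i₂ hi p
    simp only [LinearMap.coprod_apply, LinearIsometry.coe_toLinearMap]
    rw [norm_add_sq_eq_norm_sq_add_norm_sq_of_inner_eq_zero _ _ (hi _ _)]
    simp
  have hι : ∀ x y, inner ℝ (ι₁ x) (ι₂ y) = 0 := by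
    intro x y
    obtain ⟨x, rfl⟩ := N.surjective x
    obtain ⟨y, rfl⟩ := M.surjective y
    rw [← hN, ← hM, LinearMap.adjoint_inner_right]
    simpa using hj x y
  let I₀ : E × F →ₗ[ℝ] V := j₁.toLinearMap.coprod j₂.toLinearMap
  let O : E × F →ₗ[ℝ] V := ι₁.toLinearMap.coprod ι₂.toLinearMap
  have hI₀ : Function.Injective I₀ := by
    rw [injective_iff_map_eq_zero]
    intro p hp
    have h := norm_coprod j₁ j₂ hj p
    rw [show j₁.toLinearMap.coprod j₂.toLinearMap p = 0 from hp] at h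
    simp only [norm_zero, mul_zero] at h
    refine Prod.ext (norm_eq_zero.1 ?_) (norm_eq_zero.1 ?_) <;>
      nlinarith [norm_nonneg p.1, norm_nonneg p.2, mul_self_nonneg ‖p.1‖, mul_self_nonneg ‖p.2‖]
  let I : (E × F) ≃ₗ[ℝ] V := LinearEquiv.ofInjectiveOfFinrankEq I₀ hI₀ (by simp [hrank])
  have hI : ∀ p, I p = I₀ p := fun p => rfl
  have hIsymm : ∀ v, I.symm v =
      (LinearMap.adjoint j₁.toLinearMap v, LinearMap.adjoint j₂.toLinearMap v) := by
    intro v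
    obtain ⟨p, rfl⟩ := I.surjective v
    rw [LinearEquiv.symm_apply_apply, hI]
    refine Prod.ext (ext_inner_right ℝ fun x => ?_) (ext_inner_right ℝ fun y => ?_)
    · simp only [LinearMap.adjoint_inner_left, I₀, LinearMap.coprod_apply,
        LinearIsometry.coe_toLinearMap, inner_add_left, LinearIsometry.inner_map_map]
      rw [real_inner_comm (j₁ x), hj, add_zero]
    · simp only [LinearMap.adjoint_inner_left, I₀, LinearMap.coprod_apply,
        LinearIsometry.coe_toLinearMap, inner_add_left, LinearIsometry.inner_map_map]
      rw [hj, zero_add]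
  have hOI : |LinearMap.det (O ∘ₗ I.symm.toLinearMap)| = 1 := by
    let u : V →ₗᵢ[ℝ] V := ⟨O ∘ₗ I.symm.toLinearMap, fun v => by
      obtain ⟨p, rfl⟩ := I.surjective v
      have h1 := norm_coprod j₁ j₂ hj p
      have h2 := norm_coprod ι₁ ι₂ hι p
      rw [← h2, mul_self_inj (norm_nonneg _) (norm_nonneg _)] at h1
      rw [LinearMap.comp_apply, LinearEquiv.coe_coe, LinearEquiv.symm_apply_apply]
      exact h1.symm⟩
    rw [← LinearMap.normDet_eq_abs_det]
    exact u.normDet_eq_one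
  let C : F →ₗ[ℝ] V := LinearMap.adjoint T.toLinearMap ∘ₗ j₂.toLinearMap
  have hC : C = ι₂.toLinearMap ∘ₗ M.toLinearMap := LinearMap.ext hM
  have hD : LinearMap.det (LinearMap.adjoint C ∘ₗ C) = |LinearMap.det M.toLinearMap| ^ 2 := by
    rw [hC, LinearMap.adjoint_comp, LinearMap.comp_assoc,
      ← LinearMap.comp_assoc M.toLinearMap]
    have : LinearMap.adjoint ι₂.toLinearMap ∘ₗ ι₂.toLinearMap = LinearMap.id := by
      refine LinearMap.ext fun x => ext_inner_right ℝ fun y => ?_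
      simp
    rw [this, LinearMap.id_comp, ← LinearMap.normDet_eq_abs_det]
    exact (LinearMap.normDet_sq M.toLinearMap).symm
  have key : I.symm.toLinearMap ∘ₗ (T.toLinearMap ∘ₗ (O ∘ₗ I.symm.toLinearMap)) ∘ₗ I.toLinearMap ∘ₗ
      LinearMap.prodMap N.toLinearMap M.toLinearMap =
      (LinearMap.fst ℝ E F + (LinearMap.adjoint j₁.toLinearMap ∘ₗ T.toLinearMap ∘ₗ C) ∘ₗ
        LinearMap.snd ℝ E F).prod ((LinearMap.adjoint C ∘ₗ C) ∘ₗ LinearMap.snd ℝ E F) := by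
    refine LinearMap.ext fun p => ?_
    have hO : O (N p.1, M p.2) = T.symm (j₁ p.1) + C p.2 := by
      simp [O, hN, hC]
    have hadj : LinearMap.adjoint C = LinearMap.adjoint j₂.toLinearMap ∘ₗ T.toLinearMap := by
      simp [C, LinearMap.adjoint_comp]
    have h1 : I.symm (T (T.symm (j₁ p.1) + C p.2)) = (p.1, 0) + I.symm (T (C p.2)) := by
      rw [map_add, map_add, LinearEquiv.apply_symm_apply]
      congr 1
      rw [LinearEquiv.symm_apply_eq, hI]
      simp [I₀]
    simp only [LinearMap.comp_apply, LinearMap.prodMap_apply, LinearEquiv.coe_coe,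
      LinearEquiv.symm_apply_apply, hO, h1, hadj]
    rw [hIsymm]
    simp
  have hdet := congrArg (fun f => |LinearMap.det f|) key
  have hassoc : I.symm.toLinearMap ∘ₗ (T.toLinearMap ∘ₗ (O ∘ₗ I.symm.toLinearMap)) ∘ₗ
      I.toLinearMap ∘ₗ LinearMap.prodMap N.toLinearMap M.toLinearMap =
      (I.symm.toLinearMap ∘ₗ (T.toLinearMap ∘ₗ (O ∘ₗ I.symm.toLinearMap)) ∘ₗ
        I.symm.symm.toLinearMap) ∘ₗ LinearMap.prodMap N.toLinearMap M.toLinearMap := rfl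
  simp only [hassoc] at hdet
  rw [LinearMap.det_comp, LinearMap.det_conj, LinearMap.det_comp, LinearMap.det_prodMap,
    LinearMap.det_prod_shear, hD, abs_mul, abs_mul, abs_mul, hOI, abs_pow, abs_abs] at hdet
  have hM0 : |LinearMap.det M.toLinearMap| ≠ 0 := abs_ne_zero.2 (LinearEquiv.isUnit_det' M).ne_zero
  apply mul_right_cancel₀ hM0
  rw [← sq, ← hdet]
  ring

end LinearAlgebra

section SphereAveraging

open Module Measure
open scoped ENNReal

variable {Ω E : Type*} [MeasurableSpace Ω] [NormedAddCommGroup E] [NormedSpace ℝ E]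
  [MeasurableSpace E]

/-- A random isometry of `E`, homogeneous, such that the image of a vector has a distribution
depending only on the norm of that vector. -/
structure IsSphereAveraging (ρ : Measure Ω) (a : Ω → E → E) : Prop where
  measurable : Measurable fun p : Ω × E => a p.1 p.2
  isometry : ∀ ω, Isometry (a ω)
  surjective : ∀ ω, Function.Surjective (a ω)
  smul : ∀ ω (r : ℝ) x, a ω (r • x) = r • a ω x
  map_eq : ∀ x y, ‖x‖ = ‖y‖ → ρ.map (fun ω => a ω x) = ρ.map (fun ω => a ω y)

namespace IsSphereAveraging

variable {ρ : Measure Ω} {a : Ω → E → E}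

theorem measurable_apply (h : IsSphereAveraging ρ a) (x : E) : Measurable fun ω => a ω x :=
  h.measurable.comp measurable_prodMk_right

theorem norm_map (h : IsSphereAveraging ρ a) (ω : Ω) (x : E) : ‖a ω x‖ = ‖x‖ := by
  have h0 : a ω 0 = 0 := by simpa using h.smul ω 0 0
  simpa [h0] using (h.isometry ω).dist_eq x 0

theorem measurePreserving_hausdorff [BorelSpace E] (h : IsSphereAveraging ρ a) (ω : Ω) (d : ℝ) :
    MeasurePreserving (a ω) μH[d] μH[d] :=
  (IsometryEquiv.mk (Equiv.ofBijective (a ω) ⟨(h.isometry ω).injective, h.surjective ω⟩)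
    (h.isometry ω)).measurePreserving_hausdorffMeasure d

theorem lintegral_map_eq (h : IsSphereAveraging ρ a) {F : E → ℝ≥0∞} (hF : Measurable F) {x y : E}
    (hxy : ‖x‖ = ‖y‖) : ∫⁻ ω, F (a ω x) ∂ρ = ∫⁻ ω, F (a ω y) ∂ρ := by
  rw [← lintegral_map hF (h.measurable_apply x), h.map_eq x y hxy,
    lintegral_map hF (h.measurable_apply y)]

theorem lintegral_eq [IsProbabilityMeasure ρ] (h : IsSphereAveraging ρ a) {ν : Measure E}
    [SFinite ν] (hν : ∀ ω, MeasurePreserving (a ω) ν ν) {F : E → ℝ≥0∞} (hF : Measurable F) :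
    ∫⁻ x, F x ∂ν = ∫⁻ x, ∫⁻ ω, F (a ω x) ∂ρ ∂ν := by
  rw [lintegral_lintegral_swap (f := fun x ω => F (a ω x))
    ((hF.comp (h.measurable.comp measurable_swap)).aemeasurable)]
  simp_rw [(hν _).lintegral_comp hF]
  simp

theorem measure_eq [BorelSpace E] [IsProbabilityMeasure ρ] (h : IsSphereAveraging ρ a)
    {ν : Measure E}
    [SFinite ν] (hν : ∀ ω, MeasurePreserving (a ω) ν ν) (hs : ν (sphere 0 1)ᶜ = 0)
    {e : E} (he : ‖e‖ = 1) : ν = ν Set.univ • ρ.map (fun ω => a ω e) := by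
  ext s hs'
  have hF : Measurable (s.indicator (1 : E → ℝ≥0∞)) := measurable_one.indicator hs'
  rw [← lintegral_indicator_one hs', h.lintegral_eq hν hF, Measure.smul_apply,
    ← lintegral_indicator_one hs', lintegral_map hF (h.measurable_apply e)]
  have : ∀ᵐ x ∂ν, ∫⁻ ω, s.indicator (1 : E → ℝ≥0∞) (a ω x) ∂ρ =
      ∫⁻ ω, s.indicator (1 : E → ℝ≥0∞) (a ω e) ∂ρ := by
    have : ∀ᵐ x ∂ν, x ∈ sphere (0 : E) 1 := hs
    filter_upwards [this] with x hx
    exact h.lintegral_map_eq hF (by rw [he]; simpa using hx)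
  rw [lintegral_congr_ae this, lintegral_const, smul_eq_mul, mul_comm]

theorem measurePreserving_restrict_sphere [BorelSpace E] (h : IsSphereAveraging ρ a) (ω : Ω)
    (d : ℝ) :
    MeasurePreserving (a ω) (μH[d].restrict (sphere 0 1)) (μH[d].restrict (sphere 0 1)) := by
  have hs : a ω ⁻¹' sphere 0 1 = sphere 0 1 := by
    ext x
    simp [h.norm_map]
  have := (h.measurePreserving_hausdorff ω d).restrict_preimage
    (isClosed_sphere (x := (0 : E)) (ε := 1)).measurableSet
  rwa [hs] at this

theorem restrict_sphere_eq [BorelSpace E] [IsProbabilityMeasure ρ] (h : IsSphereAveraging ρ a)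
    {d : ℝ} (hd : μH[d] (sphere (0 : E) 1) < ∞) {e : E} (he : ‖e‖ = 1) :
    μH[d].restrict (sphere (0 : E) 1) = μH[d] (sphere (0 : E) 1) • ρ.map fun ω => a ω e := by
  have : IsFiniteMeasure (μH[d].restrict (sphere (0 : E) 1)) :=
    ⟨by rwa [restrict_apply_univ]⟩
  have hs : μH[d].restrict (sphere (0 : E) 1) (sphere 0 1)ᶜ = 0 := by
    rw [restrict_apply isClosed_sphere.measurableSet.compl, Set.compl_inter_self, measure_empty]
  have := h.measure_eq (h.measurePreserving_restrict_sphere · d) hs he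
  rwa [restrict_apply_univ] at this

theorem lintegral_norm_pow_inv [BorelSpace E] [FiniteDimensional ℝ E] [IsProbabilityMeasure ρ]
    (h : IsSphereAveraging ρ a) (M : E ≃ₗ[ℝ] E) {e : E} (he : ‖e‖ = 1) :
    ∫⁻ ω, ENNReal.ofReal ((‖M (a ω e)‖ ^ finrank ℝ E)⁻¹) ∂ρ =
      ENNReal.ofReal |LinearMap.det M.toLinearMap|⁻¹ := by
  have hnt : Nontrivial E := ⟨e, 0, by rintro rfl; simp at he⟩
  let ν : Measure E := μH[finrank ℝ E]
  have hM : Continuous M := M.toLinearMap.continuous_of_finiteDimensional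
  have hpos : ∀ ω, 0 < ‖M (a ω e)‖ := fun ω => by
    rw [norm_pos_iff, ne_eq, LinearEquiv.map_eq_zero_iff, ← norm_eq_zero, h.norm_map, he]
    exact one_ne_zero
  have hball : MeasurableSet (M ⁻¹' ball (0 : E) 1) := (isOpen_ball.preimage hM).measurableSet
  let F : E → ℝ≥0∞ := (M ⁻¹' ball (0 : E) 1).indicator 1
  have hF : Measurable F := measurable_one.indicator hball
  have h1 : ν (M ⁻¹' ball (0 : E) 1) = ∫⁻ ω, ∫⁻ x, F (a ω (‖x‖ • e)) ∂ν ∂ρ := by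
    have hjoint : Measurable fun p : E × Ω => F (a p.2 (‖p.1‖ • e)) :=
      hF.comp (h.measurable.comp (measurable_snd.prodMk
        ((Continuous.measurable (by fun_prop : Continuous fun x : E => ‖x‖ • e)).comp
          measurable_fst)))
    rw [← lintegral_indicator_one hball,
      h.lintegral_eq (fun ω => h.measurePreserving_hausdorff ω _) hF,
      ← lintegral_lintegral_swap (f := fun x ω => F (a ω (‖x‖ • e))) hjoint.aemeasurable]
    refine lintegral_congr fun x => h.lintegral_map_eq hF ?_
    simp [norm_smul, he]
  have h2 : ∀ ω, ∫⁻ x, F (a ω (‖x‖ • e)) ∂ν =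
      ENNReal.ofReal ((‖M (a ω e)‖ ^ finrank ℝ E)⁻¹) * ν (ball 0 1) := by
    intro ω
    rw [← inv_pow, ← addHaar_ball ν 0 (inv_nonneg.2 (norm_nonneg _)),
      ← lintegral_indicator_one measurableSet_ball]
    refine lintegral_congr fun x => ?_
    simp only [F, h.smul, Set.indicator, Set.mem_preimage, map_smul, mem_ball_zero_iff, norm_smul,
      norm_norm, ← lt_div_iff₀ (hpos ω), one_div, Pi.one_apply]
  simp_rw [h2] at h1
  have hb0 : ν (ball 0 1) ≠ 0 := (measure_ball_pos ν 0 one_pos).ne'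
  have hbt : ν (ball 0 1) ≠ ∞ := measure_ball_lt_top.ne
  rw [lintegral_mul_const' _ _ hbt, addHaar_preimage_linearEquiv, LinearEquiv.det_coe_symm,
    abs_inv] at h1
  exact ((ENNReal.mul_left_inj hb0 hbt).1 h1).symm

end IsSphereAveraging

end SphereAveraging

section UnitaryGroup

open Module Measure
open scoped ENNReal

variable {V : Type*} [NormedAddCommGroup V] [InnerProductSpace ℂ V] [FiniteDimensional ℂ V]
  [CompleteSpace V]

theorem isCompact_unitary : IsCompact (unitary (V →L[ℂ] V) : Set (V →L[ℂ] V)) := by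
  have : ProperSpace (V →L[ℂ] V) := FiniteDimensional.proper ℂ _
  refine Metric.isCompact_of_isClosed_isBounded ?_ ?_
  · simp only [unitary, Submonoid.coe_set_mk, Subsemigroup.coe_set_mk, Set.ofPred_and]
    exact (isClosed_eq (by fun_prop) continuous_const).inter
      (isClosed_eq (by fun_prop) continuous_const)
  · refine isBounded_iff_forall_norm_le.2 ⟨1, fun u hu => ?_⟩
    refine ContinuousLinearMap.opNorm_le_bound _ zero_le_one fun x => ?_
    rw [one_mul]
    exact (Unitary.norm_map ⟨u, hu⟩ x).le

theorem exists_unitary_map_orthonormal {ι : Type*} {v w : ι → V}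
    (hv : Orthonormal ℂ v) (hw : Orthonormal ℂ w) :
    ∃ u : unitary (V →L[ℂ] V), ∀ i, u.1 (v i) = w i := by
  let b : Basis ι ℂ (Submodule.span ℂ (Set.range v)) := Basis.span hv.linearIndependent
  have hb : ∀ i, (b i : V) = v i := fun i => by simp [b, Basis.span_apply]
  have hbo : Orthonormal ℂ b :=
    ((Submodule.subtypeₗᵢ _).orthonormal_comp_iff (v := b)).1 (by
      convert hv using 1
      exact funext hb)
  let L₀ : Submodule.span ℂ (Set.range v) →ₗ[ℂ] V := b.constr ℂ w
  have hL₀ : L₀ ∘ b = w := funext fun i => by simp [L₀]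
  let L := L₀.isometryOfOrthonormal hbo (by rwa [hL₀])
  refine ⟨Unitary.linearIsometryEquiv.symm (L.extend.toLinearIsometryEquiv rfl), fun i => ?_⟩
  have h : L.extend (b i : V) = L (b i) := L.extend_apply (b i)
  rw [hb] at h
  refine h.trans ?_
  simpa [L] using congrFun hL₀ i

theorem exists_unitary_map_eq_of_norm_eq {x y : V} (h : ‖x‖ = ‖y‖) :
    ∃ u : unitary (V →L[ℂ] V), u.1 x = y := by
  rcases eq_or_ne x 0 with rfl | hx
  · exact ⟨1, by simpa [eq_comm] using h⟩
  have hx' : ‖x‖ ≠ 0 := norm_ne_zero_iff.2 hx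
  have key : ∀ z : V, ‖z‖ = ‖x‖ → Orthonormal ℂ fun _ : Unit => ((‖x‖⁻¹ : ℝ) : ℂ) • z := by
    intro z hz
    refine ⟨fun _ => ?_, fun i j hij => (hij rfl).elim⟩
    rw [norm_smul, hz]
    simp [hx']
  obtain ⟨u, hu⟩ := exists_unitary_map_orthonormal (key x rfl) (key y h.symm)
  refine ⟨u, ?_⟩
  have := hu ()
  rw [map_smul] at this
  exact smul_right_injective V (by simpa using hx') this

theorem exists_unitary_map_pair {e₁ e₂ x₁ x₂ : V} (he₁ : ‖e₁‖ = 1) (he₂ : ‖e₂‖ = 1)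
    (he : inner ℂ e₁ e₂ = 0) (hx₁ : ‖x₁‖ = 1) (hx₂ : ‖x₂‖ = 1) (hx : inner ℂ x₁ x₂ = 0) :
    ∃ u : unitary (V →L[ℂ] V), u.1 e₁ = x₁ ∧ u.1 e₂ = x₂ := by
  have key : ∀ y₁ y₂ : V, ‖y₁‖ = 1 → ‖y₂‖ = 1 → inner ℂ y₁ y₂ = 0 →
      Orthonormal ℂ ![y₁, y₂] := by
    intro y₁ y₂ h₁ h₂ h
    refine ⟨fun i => ?_, fun i j hij => ?_⟩
    · fin_cases i <;> simp [h₁, h₂]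
    · fin_cases i <;> fin_cases j <;> simp_all [inner_eq_zero_symm]
  obtain ⟨u, hu⟩ := exists_unitary_map_orthonormal (key _ _ he₁ he₂ he) (key _ _ hx₁ hx₂ hx)
  exact ⟨u, hu 0, hu 1⟩

instance : CompactSpace (unitary (V →L[ℂ] V)) := isCompact_iff_compactSpace.1 isCompact_unitary

variable (V) in
theorem exists_unitary_isMulRightInvariant : ∃ ρ : Measure (unitary (V →L[ℂ] V)),
    IsProbabilityMeasure ρ ∧ ρ.IsMulRightInvariant := by
  let K₀ : TopologicalSpace.PositiveCompacts (unitary (V →L[ℂ] V)) := ⊤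
  let ρ₀ := haarMeasure K₀
  refine ⟨ρ₀.inv, ⟨?_⟩, inferInstance⟩
  rw [Measure.inv_apply, Set.inv_univ]
  exact haarMeasure_self

theorem integral_unitary_pair_eq (ρ : Measure (unitary (V →L[ℂ] V))) [ρ.IsMulRightInvariant]
    (F : V → V → ℝ) {e₁ e₂ x₁ x₂ : V} (he₁ : ‖e₁‖ = 1) (he₂ : ‖e₂‖ = 1)
    (he : inner ℂ e₁ e₂ = 0) (hx₁ : ‖x₁‖ = 1) (hx₂ : ‖x₂‖ = 1) (hx : inner ℂ x₁ x₂ = 0) :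
    ∫ u, F (u.1 x₁) (u.1 x₂) ∂ρ = ∫ u, F (u.1 e₁) (u.1 e₂) ∂ρ := by
  obtain ⟨u, rfl, rfl⟩ := exists_unitary_map_pair he₁ he₂ he hx₁ hx₂ hx
  exact integral_mul_right_eq_self (fun v : unitary (V →L[ℂ] V) => F (v.1 e₁) (v.1 e₂)) u

variable [MeasurableSpace V] [BorelSpace V]

theorem isSphereAveraging_unitary (ρ : Measure (unitary (V →L[ℂ] V))) [ρ.IsMulRightInvariant] :
    IsSphereAveraging ρ fun u (x : V) => u.1 x where
  measurable := by
    have : ProperSpace V := FiniteDimensional.proper ℂ _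
    have : SecondCountableTopology V := inferInstance
    exact Continuous.measurable (by fun_prop)
  isometry u := (Unitary.linearIsometryEquiv u).isometry
  surjective u := (Unitary.linearIsometryEquiv u).surjective
  smul u r x := by
    rw [← Complex.coe_smul, map_smul, Complex.coe_smul]
  map_eq x y hxy := by
    obtain ⟨u, rfl⟩ := exists_unitary_map_eq_of_norm_eq hxy
    have hm : Measurable fun v : unitary (V →L[ℂ] V) => v.1 x :=
      Continuous.measurable (by fun_prop)
    have hu : Measurable fun v : unitary (V →L[ℂ] V) => v * u :=
      Continuous.measurable (by fun_prop)
    conv_lhs => rw [← map_mul_right_eq_self ρ u, Measure.map_map hm hu]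
    rfl

end UnitaryGroup

section CircleAveraging

open Module Measure
open scoped ENNReal Real

/-- The uniform probability measure on `(0, 2π]`. -/
def uniformAngle : Measure ℝ := ENNReal.ofReal (2 * π)⁻¹ • volume.restrict (Set.Ioc 0 (2 * π))

instance : IsProbabilityMeasure uniformAngle := ⟨by
  rw [uniformAngle, Measure.smul_apply, Measure.restrict_apply_univ, Real.volume_Ioc, sub_zero,
    smul_eq_mul, ← ENNReal.ofReal_mul (by positivity), inv_mul_cancel₀ (by positivity),
    ENNReal.ofReal_one]⟩

theorem integral_uniformAngle (f : ℝ → ℝ) :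
    ∫ θ, f θ ∂uniformAngle = 1 / (2 * π) * ∫ θ in 0..(2 * π), f θ := by
  rw [uniformAngle, integral_smul_measure, intervalIntegral.integral_of_le Real.two_pi_pos.le,
    ENNReal.toReal_ofReal (by positivity), smul_eq_mul, one_div]

theorem lintegral_uniformAngle_add_right {F : ℝ → ℝ≥0∞}
    (hp : Function.Periodic F (2 * π)) (α : ℝ) :
    ∫⁻ θ, F (θ + α) ∂uniformAngle = ∫⁻ θ, F θ ∂uniformAngle := by
  simp only [uniformAngle, lintegral_smul_measure]
  congr 1
  have h1 := (isAddFundamentalDomain_Ioc Real.two_pi_pos (0 + α)).setLIntegral_eq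
    (isAddFundamentalDomain_Ioc Real.two_pi_pos 0) F (by
      rintro ⟨g, hg⟩ x
      obtain ⟨k, rfl⟩ := AddSubgroup.mem_zmultiples_iff.1 hg
      rw [AddSubgroup.vadd_def, vadd_eq_add, add_comm]
      exact hp.zsmul k x)
  rw [zero_add (2 * π)] at h1
  have h2 := (measurePreserving_add_right volume α).setLIntegral_comp_emb
    (measurableEmbedding_addRight α) F (Set.Ioc 0 (2 * π))
  rw [Set.image_add_const_Ioc, zero_add] at h2
  rw [h2, ← h1, zero_add, add_comm α]

theorem isSphereAveraging_uniformAngle :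
    IsSphereAveraging uniformAngle fun θ (z : ℂ) => Complex.exp (θ * Complex.I) • z where
  measurable := Continuous.measurable (by fun_prop)
  isometry θ := Isometry.of_dist_eq fun x y => by
    rw [dist_eq_norm, ← smul_sub, norm_smul, Complex.norm_exp_ofReal_mul_I, one_mul, dist_eq_norm]
  surjective θ z := ⟨Complex.exp (-(θ * Complex.I)) • z, by
    simp only
    rw [smul_smul, ← Complex.exp_add, add_neg_cancel, Complex.exp_zero, one_smul]⟩
  smul θ r z := smul_comm _ _ _
  map_eq x y hxy := by
    obtain ⟨α, rfl⟩ : ∃ α : ℝ, Complex.exp (α * Complex.I) • x = y := by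
      refine ⟨Complex.arg y - Complex.arg x, ?_⟩
      have h := Complex.norm_mul_exp_arg_mul_I x
      calc Complex.exp ((Complex.arg y - Complex.arg x : ℝ) * Complex.I) • x
          = Complex.exp ((Complex.arg y - Complex.arg x : ℝ) * Complex.I) *
            (‖x‖ * Complex.exp (Complex.arg x * Complex.I)) := by rw [h, smul_eq_mul]
        _ = ‖y‖ * Complex.exp (Complex.arg y * Complex.I) := by
          rw [hxy, mul_left_comm, ← Complex.exp_add, ← add_mul]
          push_cast
          rw [sub_add_cancel]
        _ = y := Complex.norm_mul_exp_arg_mul_I y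
    have hm : ∀ z : ℂ, Measurable fun θ : ℝ => Complex.exp (θ * Complex.I) • z := fun z =>
      Continuous.measurable (by fun_prop)
    ext s hs
    have hF : Measurable (s.indicator (1 : ℂ → ℝ≥0∞)) := measurable_one.indicator hs
    rw [← lintegral_indicator_one hs, ← lintegral_indicator_one hs, lintegral_map hF (hm _),
      lintegral_map hF (hm _)]
    rw [← lintegral_uniformAngle_add_right (α := α)]
    · refine lintegral_congr fun θ => ?_
      rw [smul_smul, ← Complex.exp_add]
      push_cast
      rw [add_mul]
    · intro θ
      simp only
      congr 2
      push_cast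
      rw [add_mul, Complex.exp_periodic]

end CircleAveraging

section SphereHausdorff

open Module Measure
open scoped ENNReal NNReal

theorem lipschitzOnWith_inv_norm_smul {E : Type*} [NormedAddCommGroup E] [NormedSpace ℝ E] :
    LipschitzOnWith 2 (fun x : E => ‖x‖⁻¹ • x) {x | 1 ≤ ‖x‖} := by
  refine LipschitzOnWith.of_dist_le_mul fun x (hx : 1 ≤ ‖x‖) y (hy : 1 ≤ ‖y‖) => ?_
  have hx0 : 0 < ‖x‖ := by linarith
  have hy0 : 0 < ‖y‖ := by linarith
  have h1 : ‖x‖⁻¹ • x - ‖y‖⁻¹ • y = ‖x‖⁻¹ • ((x - y) + ((‖y‖ - ‖x‖) * ‖y‖⁻¹) • y) := by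
    rw [smul_add, smul_smul, smul_sub, sub_add, ← sub_smul]
    congr 2
    field_simp
    ring
  have h2 : ‖((‖y‖ - ‖x‖) * ‖y‖⁻¹) • y‖ ≤ ‖x - y‖ := by
    rw [norm_smul, norm_mul, norm_inv, norm_norm, mul_assoc, inv_mul_cancel₀ hy0.ne', mul_one,
      norm_sub_rev x y]
    exact abs_norm_sub_norm_le y x
  rw [dist_eq_norm, dist_eq_norm, h1, norm_smul, norm_inv, norm_norm]
  calc ‖x‖⁻¹ * ‖(x - y) + ((‖y‖ - ‖x‖) * ‖y‖⁻¹) • y‖ ≤ 1 * (‖x - y‖ + ‖x - y‖) := by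
        gcongr
        · exact inv_le_one_of_one_le₀ hx
        · exact (norm_add_le _ _).trans (by gcongr)
    _ = (2 : ℝ≥0) * ‖x - y‖ := by push_cast; ring

variable {E : Type*} [NormedAddCommGroup E] [InnerProductSpace ℝ E] [FiniteDimensional ℝ E]
  [MeasurableSpace E] [BorelSpace E] {d : ℕ}

theorem hausdorffMeasure_sphere_lt_top (hd : finrank ℝ E = d + 1) :
    μH[d] (sphere (0 : E) 1) < ∞ := by
  have : ProperSpace E := FiniteDimensional.proper ℝ E
  refine (isCompact_sphere (0 : E) 1).measure_lt_top_of_nhdsWithin fun v hv => ?_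
  have hv1 : ‖v‖ = 1 := by simpa using hv
  have : Fact (finrank ℝ E = d + 1) := ⟨hd⟩
  let F := (Submodule.span ℝ {v})ᗮ
  have hF : finrank ℝ F = d :=
    Submodule.finrank_orthogonal_span_singleton (by rintro rfl; simp at hv1)
  have horth : ∀ w : F, inner ℝ v (w : E) = 0 := fun w =>
    Submodule.mem_orthogonal_singleton_iff_inner_right.1 w.2
  let φ : F → E := (fun x : E => ‖x‖⁻¹ • x) ∘ fun w : F => v + w
  have hφ : LipschitzOnWith (2 * 1) φ (ball 0 2) := by
    refine lipschitzOnWith_inv_norm_smul.comp (t := {x : E | 1 ≤ ‖x‖})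
      (LipschitzWith.lipschitzOnWith (LipschitzWith.of_dist_le_mul fun x y => ?_))
      fun w _ => ?_
    · simp [Subtype.dist_eq]
    · have := norm_add_sq_eq_norm_sq_add_norm_sq_of_inner_eq_zero v (w : E) (horth w)
      simp only [Set.mem_ofPred_eq]
      nlinarith [norm_nonneg (v + w), norm_nonneg (w : E)]
  refine ⟨φ '' ball 0 2, ?_, ?_⟩
  · have hU : {x : E | 1 / 2 < inner ℝ v x} ∈ nhds v := by
      refine (isOpen_lt continuous_const (by fun_prop)).mem_nhds ?_
      simp only [Set.mem_ofPred_eq, real_inner_self_eq_norm_sq, hv1]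
      norm_num
    filter_upwards [mem_nhdsWithin_of_mem_nhds hU, self_mem_nhdsWithin] with x hx hxs
    have hx1 : ‖x‖ = 1 := by simpa using hxs
    have hc : 1 / 2 < inner ℝ v x := hx
    have hc0 : 0 < inner ℝ v x := by linarith
    let w : F := ⟨(inner ℝ v x)⁻¹ • x - v, Submodule.mem_orthogonal_singleton_iff_inner_right.2 (by
      rw [inner_sub_right, inner_smul_right, real_inner_self_eq_norm_sq, hv1]
      field_simp
      norm_num)⟩
    have hvw : v + (w : E) = (inner ℝ v x)⁻¹ • x := add_sub_cancel _ _
    have hn : ‖v + (w : E)‖ = (inner ℝ v x)⁻¹ := by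
      rw [hvw, norm_smul, hx1, mul_one, Real.norm_of_nonneg (inv_nonneg.2 hc0.le)]
    refine ⟨w, ?_, ?_⟩
    · have h := norm_add_sq_eq_norm_sq_add_norm_sq_of_inner_eq_zero v (w : E) (horth w)
      have h2 : (inner ℝ v x)⁻¹ < 2 := by
        rw [inv_lt_comm₀ hc0 two_pos]
        simpa using hc
      rw [hn, hv1] at h
      rw [mem_ball_zero_iff, Submodule.coe_norm]
      nlinarith [norm_nonneg (w : E), inv_pos.2 hc0]
    · simp only [φ, Function.comp_apply]
      rw [hn, hvw, smul_smul, inv_inv, mul_inv_cancel₀ hc0.ne', one_smul]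
  · have : (μH[(d : ℝ)] : Measure F).IsAddHaarMeasure := by rw [← hF]; infer_instance
    exact (hφ.hausdorffMeasure_image_le d.cast_nonneg).trans_lt
      (ENNReal.mul_lt_top (by simp) measure_ball_lt_top)

theorem hausdorffMeasure_sphere_pos (hd : finrank ℝ E = d + 1) :
    0 < μH[d] (sphere (0 : E) 1) := by
  have : Nontrivial E := finrank_pos_iff.1 (by omega : 0 < finrank ℝ E)
  obtain ⟨v, hv1⟩ := exists_norm_eq E zero_le_one
  have : Fact (finrank ℝ E = d + 1) := ⟨hd⟩
  let F := (Submodule.span ℝ {v})ᗮ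
  have hF : finrank ℝ F = d :=
    Submodule.finrank_orthogonal_span_singleton (by rintro rfl; simp at hv1)
  have horth : ∀ w : F, inner ℝ v (w : E) = 0 := fun w =>
    Submodule.mem_orthogonal_singleton_iff_inner_right.1 w.2
  have hP : LipschitzWith 1 F.orthogonalProjectionOnto := F.lipschitzWith_orthogonalProjectionOnto
  have hsub : ball (0 : F) 1 ⊆ F.orthogonalProjectionOnto '' sphere 0 1 := by
    intro w hw
    have hw1 : ‖w‖ < 1 := by simpa using hw
    refine ⟨Real.sqrt (1 - ‖w‖ ^ 2) • v + w, ?_, ?_⟩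
    · have := norm_add_sq_eq_norm_sq_add_norm_sq_of_inner_eq_zero
        (Real.sqrt (1 - ‖w‖ ^ 2) • v) (w : E) (by rw [inner_smul_left, horth, mul_zero])
      rw [norm_smul, hv1, mul_one, Real.norm_of_nonneg (Real.sqrt_nonneg _),
        Real.mul_self_sqrt (by nlinarith [norm_nonneg w]), Submodule.coe_norm] at this
      rw [Submodule.coe_norm, mem_sphere_zero_iff_norm, ← sq_eq_sq₀ (norm_nonneg _) zero_le_one]
      nlinarith
    · rw [map_add, map_smul]
      rw [F.orthogonalProjectionOnto_mem_subspace_eq_self,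
        F.orthogonalProjectionOnto_apply_of_mem_orthogonal, smul_zero, zero_add]
      exact Submodule.le_orthogonal_orthogonal _ (Submodule.mem_span_singleton_self v)
  have : (μH[(d : ℝ)] : Measure F).IsAddHaarMeasure := by rw [← hF]; infer_instance
  calc 0 < μH[d] (ball (0 : F) 1) := measure_ball_pos _ _ one_pos
    _ ≤ μH[d] (F.orthogonalProjectionOnto '' sphere 0 1) := measure_mono hsub
    _ ≤ (1 : ℝ≥0) ^ (d : ℝ) * μH[d] (sphere (0 : E) 1) := hP.hausdorffMeasure_image_le d.cast_nonneg _
    _ = μH[d] (sphere (0 : E) 1) := by simp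

end SphereHausdorff

section SectionFormula

open Module Measure
open scoped ENNReal Real

variable {V F : Type*} [NormedAddCommGroup V] [InnerProductSpace ℂ V] [FiniteDimensional ℂ V]
  [NormedAddCommGroup F] [InnerProductSpace ℂ F] [FiniteDimensional ℂ F]

omit [FiniteDimensional ℂ V] in
theorem injective_of_re_inner_eq (T : V ≃ₗ[ℝ] V) (B : V →ₗ[ℝ] V)
    (hB : ∀ a b, (inner ℂ (B a) b).re = (inner ℂ a (T b)).re) : Function.Injective B := by
  rw [injective_iff_map_eq_zero]
  intro a ha
  have h := hB a (T.symm a)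
  rw [ha, inner_zero_left, LinearEquiv.apply_symm_apply] at h
  exact (inner_self_eq_zero (𝕜 := ℂ)).1 (Complex.ext h.symm (inner_self_im (𝕜 := ℂ) a))

theorem lintegral_unitary_norm_adjoint_pow_inv [CompleteSpace F] (T : V ≃ₗ[ℝ] V) (B : V →ₗ[ℝ] V)
    (hB : ∀ a b, (inner ℂ (B a) b).re = (inner ℂ a (T b)).re) {x : V} (hx : ‖x‖ = 1)
    (j : F →ₗᵢ[ℂ] V) (hj : ∀ y, inner ℂ x (j y) = 0) (hrank : finrank ℂ V = 1 + finrank ℂ F)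
    {e : F} (he : ‖e‖ = 1) (ρ : Measure (unitary (F →L[ℂ] F))) [IsProbabilityMeasure ρ]
    [ρ.IsMulRightInvariant] :
    ∫⁻ u, ENNReal.ofReal ((‖B (j (u.1 e))‖ ^ (2 * finrank ℂ F))⁻¹) ∂ρ =
      ENNReal.ofReal |LinearMap.det T.toLinearMap|⁻¹ *
        ∫⁻ θ : ℝ, ENNReal.ofReal ((‖T.symm (Complex.exp (θ * Complex.I) • x)‖ ^ 2)⁻¹)
          ∂uniformAngle := by
  let : InnerProductSpace ℝ V := InnerProductSpace.complexToReal
  let : InnerProductSpace ℝ F := InnerProductSpace.complexToReal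
  let : MeasurableSpace F := borel F
  have : BorelSpace F := ⟨rfl⟩
  have : FiniteDimensional ℝ V := FiniteDimensional.complexToReal V
  have : FiniteDimensional ℝ F := FiniteDimensional.complexToReal F
  have hBadj : B = LinearMap.adjoint T.toLinearMap :=
    (LinearMap.eq_adjoint_iff _ _).2 hB
  let j₁ : ℂ →ₗᵢ[ℝ] V :=
    ⟨((LinearMap.toSpanSingleton ℂ V x).restrictScalars ℝ), fun z => by simp [norm_smul, hx]⟩
  let j₂ : F →ₗᵢ[ℝ] V := ⟨j.toLinearMap.restrictScalars ℝ, fun y => by simp⟩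
  have hBinj : Function.Injective B := injective_of_re_inner_eq T B hB
  obtain ⟨N, ι₁, hN⟩ := exists_comp_linearIsometry_eq (T.symm.toLinearMap ∘ₗ j₁.toLinearMap)
    (T.symm.injective.comp j₁.injective)
  obtain ⟨M, ι₂, hM⟩ := exists_comp_linearIsometry_eq (B ∘ₗ j₂.toLinearMap)
    (hBinj.comp j₂.injective)
  have hdet := abs_det_eq_of_orthogonal j₁ j₂ (fun z y => ?_) ?_ T N ι₁ hN M ι₂
    (by rw [← hBadj]; exact hM)
  · have h1 := isSphereAveraging_uniformAngle.lintegral_norm_pow_inv N (e := 1) (by simp)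
    have h2 := (isSphereAveraging_unitary ρ).lintegral_norm_pow_inv M he
    rw [finrank_real_of_complex] at h2
    rw [Complex.finrank_real_complex] at h1
    have h3 : ∀ θ : ℝ, ‖N (Complex.exp (θ * Complex.I) • (1 : ℂ))‖ =
        ‖T.symm (Complex.exp (θ * Complex.I) • x)‖ := fun θ => by
      rw [← ι₁.norm_map, ← hN]
      simp [j₁]
    have h4 : ∀ u : unitary (F →L[ℂ] F), ‖M (u.1 e)‖ = ‖B (j (u.1 e))‖ := fun u => by
      rw [← ι₂.norm_map, ← hM]
      rfl
    simp only [h3] at h1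
    simp only [h4] at h2
    rw [h1, h2, hdet, mul_inv, ENNReal.ofReal_mul (by positivity)]
  · change (inner ℂ (z • x) (j y)).re = 0
    rw [inner_smul_left, hj, mul_zero, Complex.zero_re]
  · rw [Complex.finrank_real_complex, finrank_real_of_complex, finrank_real_of_complex, hrank,
      mul_add, mul_one]

end SectionFormula

section HyperplaneSections

open Module Measure
open scoped ENNReal Real

variable {V : Type*} [NormedAddCommGroup V] [InnerProductSpace ℂ V] [FiniteDimensional ℂ V]
  [MeasurableSpace V] [BorelSpace V]

/-- The surface measure, of dimension `d`, on the section of the unit sphere by the complex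
hyperplane orthogonal to `x`. -/
def sectionMeasure (d : ℝ) (x : V) : Measure V :=
  μH[d].restrict (sphere 0 1 ∩ ((Submodule.span ℂ {x})ᗮ : Submodule ℂ V))

omit [FiniteDimensional ℂ V] [MeasurableSpace V] [BorelSpace V] in
theorem mem_orthogonal_span_singleton {x y : V} :
    y ∈ ((Submodule.span ℂ {x})ᗮ : Submodule ℂ V) ↔ inner ℂ x y = 0 :=
  Submodule.mem_orthogonal_singleton_iff_inner_right

omit [FiniteDimensional ℂ V] in
theorem measurableSet_sphere_inter_orthogonal (x : V) :
    MeasurableSet (sphere 0 1 ∩ ((Submodule.span ℂ {x})ᗮ : Submodule ℂ V) : Set V) :=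
  isClosed_sphere.measurableSet.inter (Submodule.isClosed_orthogonal _).measurableSet

omit [FiniteDimensional ℂ V] in
theorem ae_sectionMeasure (d : ℝ) (x : V) :
    ∀ᵐ y ∂sectionMeasure d x, ‖y‖ = 1 ∧ inner ℂ x y = 0 := by
  filter_upwards [ae_restrict_mem (measurableSet_sphere_inter_orthogonal x)] with y hy
  exact ⟨by simpa using hy.1, mem_orthogonal_span_singleton.1 hy.2⟩

omit [FiniteDimensional ℂ V] in
theorem sectionMeasure_map [CompleteSpace V] (d : ℝ) (u : unitary (V →L[ℂ] V)) (x : V) :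
    MeasurePreserving u.1 (sectionMeasure d x) (sectionMeasure d (u.1 x)) := by
  have h : MeasurePreserving u.1 (μH[d] : Measure V) μH[d] :=
    (Unitary.linearIsometryEquiv u).toIsometryEquiv.measurePreserving_hausdorffMeasure d
  have hs : u.1 ⁻¹' (sphere 0 1 ∩ ((Submodule.span ℂ {u.1 x})ᗮ : Submodule ℂ V)) =
      sphere 0 1 ∩ ((Submodule.span ℂ {x})ᗮ : Submodule ℂ V) := by
    ext y
    simp only [Set.mem_inter_iff, mem_sphere_zero_iff_norm, SetLike.mem_coe,
      mem_orthogonal_span_singleton, Set.mem_preimage, Unitary.norm_map, Unitary.inner_map_map]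
  have := h.restrict_preimage (measurableSet_sphere_inter_orthogonal (u.1 x))
  rwa [hs] at this

omit [FiniteDimensional ℂ V] in
theorem sectionMeasure_eq_map {d : ℝ} (hd : 0 ≤ d) (x : V) :
    sectionMeasure d x = ((μH[d] : Measure ((Submodule.span ℂ {x})ᗮ : Submodule ℂ V)).restrict
      (sphere 0 1)).map Subtype.val := by
  have hsp : (sphere 0 1 : Set ((Submodule.span ℂ {x})ᗮ : Submodule ℂ V)) =
      Subtype.val ⁻¹' sphere (0 : V) 1 := by
    ext y
    simp
  rw [hsp, ← restrict_map measurable_subtype_coe isClosed_sphere.measurableSet,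
    isometry_subtype_coe.map_hausdorffMeasure (Or.inl hd),
    restrict_restrict isClosed_sphere.measurableSet, Subtype.range_coe, sectionMeasure]

theorem hausdorffMeasure_complex_sphere {m : ℕ} (hV : finrank ℂ V = m + 1) :
    0 < μH[(2 * m + 1 : ℕ)] (sphere (0 : V) 1) ∧ μH[(2 * m + 1 : ℕ)] (sphere (0 : V) 1) < ∞ := by
  let : InnerProductSpace ℝ V := InnerProductSpace.complexToReal
  have : FiniteDimensional ℝ V := FiniteDimensional.complexToReal V
  have hd : finrank ℝ V = 2 * m + 1 + 1 := by rw [finrank_real_of_complex, hV]; ring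
  exact ⟨hausdorffMeasure_sphere_pos hd, hausdorffMeasure_sphere_lt_top hd⟩

variable {m : ℕ}

omit [FiniteDimensional ℂ V] [MeasurableSpace V] [BorelSpace V] in
theorem finrank_orthogonal_span_singleton_complex (hV : finrank ℂ V = m + 2) {x : V}
    (hx : ‖x‖ = 1) : finrank ℂ ((Submodule.span ℂ {x})ᗮ : Submodule ℂ V) = m + 1 := by
  have : Fact (finrank ℂ V = m + 1 + 1) := ⟨hV⟩
  exact Submodule.finrank_orthogonal_span_singleton (by rintro rfl; simp at hx)

theorem sectionMeasure_univ_pos_lt_top (hV : finrank ℂ V = m + 2) {x : V} (hx : ‖x‖ = 1) :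
    0 < sectionMeasure (2 * m + 1 : ℕ) x Set.univ ∧
      sectionMeasure (2 * m + 1 : ℕ) x Set.univ < ∞ := by
  rw [sectionMeasure_eq_map (Nat.cast_nonneg _), map_apply measurable_subtype_coe .univ,
    Set.preimage_univ, restrict_apply_univ]
  exact hausdorffMeasure_complex_sphere (finrank_orthogonal_span_singleton_complex hV hx)

theorem lintegral_sectionMeasure_norm_adjoint_pow_inv (hV : finrank ℂ V = m + 2)
    (T : V ≃ₗ[ℝ] V) (B : V →ₗ[ℝ] V) (hB : ∀ a b, (inner ℂ (B a) b).re = (inner ℂ a (T b)).re)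
    {x : V} (hx : ‖x‖ = 1) :
    ∫⁻ y, ENNReal.ofReal ((‖B y‖ ^ (2 * (m + 1)))⁻¹) ∂sectionMeasure (2 * m + 1 : ℕ) x =
      sectionMeasure (2 * m + 1 : ℕ) x Set.univ *
        (ENNReal.ofReal |LinearMap.det T.toLinearMap|⁻¹ *
          ∫⁻ θ : ℝ, ENNReal.ofReal ((‖T.symm (Complex.exp (θ * Complex.I) • x)‖ ^ 2)⁻¹)
            ∂uniformAngle) := by
  let F := ((Submodule.span ℂ {x})ᗮ : Submodule ℂ V)
  have hF : finrank ℂ F = m + 1 := finrank_orthogonal_span_singleton_complex hV hx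
  have : CompleteSpace F := FiniteDimensional.complete ℂ F
  have : Nontrivial F := finrank_pos_iff.1 (by omega : 0 < finrank ℂ F)
  obtain ⟨e, he⟩ := exists_norm_eq F zero_le_one
  obtain ⟨ρ, hρ, hρ'⟩ := exists_unitary_isMulRightInvariant F
  have key := lintegral_unitary_norm_adjoint_pow_inv T B hB hx F.subtypeₗᵢ
    (fun y => mem_orthogonal_span_singleton.1 y.2) (by rw [hV, hF]; ring) he ρ
  have hBc : Continuous B := by
    have : FiniteDimensional ℝ V := FiniteDimensional.complexToReal V
    exact B.continuous_of_finiteDimensional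
  have hBm : Measurable fun y : V => ENNReal.ofReal ((‖B y‖ ^ (2 * (m + 1)))⁻¹) :=
    ((hBc.norm.pow _).measurable.inv).ennreal_ofReal
  have hBm' : Measurable fun y : F => ENNReal.ofReal ((‖B y‖ ^ (2 * (m + 1)))⁻¹) :=
    hBm.comp measurable_subtype_coe
  have havg := isSphereAveraging_unitary ρ
  rw [← key, sectionMeasure_eq_map (Nat.cast_nonneg _), lintegral_map hBm measurable_subtype_coe,
    havg.restrict_sphere_eq (hausdorffMeasure_complex_sphere hF).2 he, lintegral_smul_measure,
    lintegral_map hBm' (havg.measurable_apply e), hF,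
    map_apply measurable_subtype_coe .univ, Set.preimage_univ, Measure.smul_apply,
    map_apply (havg.measurable_apply e) .univ, Set.preimage_univ, measure_univ, smul_eq_mul,
    smul_eq_mul, mul_one]
  rfl

end HyperplaneSections

section Duality

open Module Measure
open scoped ENNReal Real

variable {V : Type*} [NormedAddCommGroup V] [InnerProductSpace ℂ V] [FiniteDimensional ℂ V]
  [CompleteSpace V] [MeasurableSpace V] [BorelSpace V] {m : ℕ}

omit [FiniteDimensional ℂ V] in
theorem integral_sectionMeasure_unitary (d : ℝ) (u : unitary (V →L[ℂ] V)) (x : V) {f : V → ℝ} :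
    ∫ y, f y ∂sectionMeasure d (u.1 x) = ∫ y, f (u.1 y) ∂sectionMeasure d x :=
  ((sectionMeasure_map d u x).integral_comp
    (Unitary.linearIsometryEquiv u).toHomeomorph.measurableEmbedding f).symm

theorem integral_unitary_mul_sectionMeasure (hV : finrank ℂ V = m + 2)
    (ρ : Measure (unitary (V →L[ℂ] V))) [IsProbabilityMeasure ρ] [ρ.IsMulRightInvariant]
    {f w : V → ℝ} (hf : Measurable f) (hw : Measurable w) {C D : ℝ}
    (hfC : ∀ x, ‖x‖ = 1 → ‖f x‖ ≤ C) (hwD : ∀ x, ‖x‖ = 1 → ‖w x‖ ≤ D)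
    {e₁ e₂ : V} (he₁ : ‖e₁‖ = 1) (he₂ : ‖e₂‖ = 1) (he : inner ℂ e₁ e₂ = 0) :
    ∫ u, w (u.1 e₁) * ∫ y, f y ∂sectionMeasure (2 * m + 1 : ℕ) (u.1 e₁) ∂ρ =
      (sectionMeasure (2 * m + 1 : ℕ) e₁).real Set.univ * ∫ u, w (u.1 e₁) * f (u.1 e₂) ∂ρ := by
  have hfin : IsFiniteMeasure (sectionMeasure (2 * m + 1 : ℕ) e₁) :=
    ⟨(sectionMeasure_univ_pos_lt_top hV he₁).2⟩
  have havg := isSphereAveraging_unitary ρ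
  have hmeas : Measurable fun p : unitary (V →L[ℂ] V) × V => w (p.1.1 e₁) * f (p.1.1 p.2) :=
    (hw.comp ((havg.measurable_apply e₁).comp measurable_fst)).mul (hf.comp havg.measurable)
  have hint : Integrable (fun p : unitary (V →L[ℂ] V) × V => w (p.1.1 e₁) * f (p.1.1 p.2))
      (ρ.prod (sectionMeasure (2 * m + 1 : ℕ) e₁)) := by
    refine Integrable.of_bound hmeas.aestronglyMeasurable (D * C) ?_
    have h := (ae_sectionMeasure (2 * m + 1 : ℕ) e₁)
    have h' := Measure.quasiMeasurePreserving_snd (μ := ρ) |>.ae h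
    filter_upwards [h'] with p hp
    rw [norm_mul]
    gcongr
    · exact (norm_nonneg _).trans (hwD e₁ he₁)
    · exact hwD _ (by rw [Unitary.norm_map, he₁])
    · exact hfC _ (by rw [Unitary.norm_map, hp.1])
  simp_rw [integral_sectionMeasure_unitary, ← integral_const_mul]
  rw [integral_integral_swap hint]
  have : ∀ᵐ y ∂sectionMeasure (2 * m + 1 : ℕ) e₁,
      ∫ u, w (u.1 e₁) * f (u.1 y) ∂ρ = ∫ u, w (u.1 e₁) * f (u.1 e₂) ∂ρ := by
    filter_upwards [ae_sectionMeasure (2 * m + 1 : ℕ) e₁] with y hy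
    exact integral_unitary_pair_eq ρ (fun a b => w a * f b) he₁ he₂ he he₁ hy.1 hy.2
  rw [integral_congr_ae this, integral_const, smul_eq_mul, integral_const_mul]

theorem measurable_integral_sectionMeasure (hV : finrank ℂ V = m + 2) {f : V → ℝ}
    (hf : Measurable f) : Measurable fun x : sphere (0 : V) 1 =>
      ∫ y, f y ∂sectionMeasure (2 * m + 1 : ℕ) (x : V) := by
  have : Nontrivial V := finrank_pos_iff.1 (by omega : 0 < finrank ℂ V)
  obtain ⟨e, he⟩ := exists_norm_eq V zero_le_one
  have hfin : IsFiniteMeasure (sectionMeasure (2 * m + 1 : ℕ) e) :=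
    ⟨(sectionMeasure_univ_pos_lt_top hV he).2⟩
  let o : unitary (V →L[ℂ] V) → sphere (0 : V) 1 := fun u =>
    ⟨u.1 e, by rw [mem_sphere_zero_iff_norm, Unitary.norm_map, he]⟩
  have ho : Continuous o := Continuous.subtype_mk (by fun_prop) _
  have hos : Function.Surjective o := fun x => by
    obtain ⟨u, hu⟩ := exists_unitary_map_eq_of_norm_eq (x := e) (y := x) (by simp [he])
    exact ⟨u, Subtype.ext hu⟩
  have : PolishSpace (V →L[ℂ] V) := by
    have : ProperSpace (V →L[ℂ] V) := FiniteDimensional.proper ℂ _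
    infer_instance
  have : PolishSpace (unitary (V →L[ℂ] V)) := isCompact_unitary.isClosed.polishSpace
  rw [← ho.measurable.measurable_comp_iff_of_surjective hos]
  simp only [Function.comp_def, o, integral_sectionMeasure_unitary]
  have hm : Measurable fun p : unitary (V →L[ℂ] V) × V => f (p.1.1 p.2) :=
    hf.comp (Continuous.measurable (by fun_prop))
  exact hm.stronglyMeasurable.integral_prod_right.measurable

theorem integral_sphere_mul_sectionMeasure_comm (hV : finrank ℂ V = m + 2)
    {f w : V → ℝ} (hf : Measurable f) (hw : Measurable w) {C D : ℝ}
    (hfC : ∀ x, ‖x‖ = 1 → ‖f x‖ ≤ C) (hwD : ∀ x, ‖x‖ = 1 → ‖w x‖ ≤ D) :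
    ∫ x in sphere (0 : V) 1, w x * ∫ y, f y ∂sectionMeasure (2 * m + 1 : ℕ) x
        ∂μH[(2 * (m + 1) + 1 : ℕ)] =
      ∫ x in sphere (0 : V) 1, f x * ∫ y, w y ∂sectionMeasure (2 * m + 1 : ℕ) x
        ∂μH[(2 * (m + 1) + 1 : ℕ)] := by
  obtain ⟨e, he⟩ : ∃ e : Fin 2 → V, Orthonormal ℂ e :=
    ⟨_, (stdOrthonormalBasis ℂ V).orthonormal.comp (Fin.castLE (by omega : 2 ≤ finrank ℂ V))
      (Fin.castLE_injective _)⟩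
  have he₁ : ‖e 0‖ = 1 := he.1 0
  have he₂ : ‖e 1‖ = 1 := he.1 1
  have he₁₂ : inner ℂ (e 0) (e 1) = 0 := he.2 (by simp)
  have he₂₁ : inner ℂ (e 1) (e 0) = 0 := he.2 (by simp)
  obtain ⟨ρ, hρ, hρ'⟩ := exists_unitary_isMulRightInvariant V
  have havg := isSphereAveraging_unitary ρ
  have hσpos := hausdorffMeasure_complex_sphere (V := V) (m := m + 1) hV
  have hσ := havg.restrict_sphere_eq hσpos.2 he₁
  have hsm : ∀ g h : V → ℝ, Measurable g → Measurable h →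
      ∫ x in sphere (0 : V) 1, g x * ∫ y, h y ∂sectionMeasure (2 * m + 1 : ℕ) x
        ∂μH[(2 * (m + 1) + 1 : ℕ)] = (μH[(2 * (m + 1) + 1 : ℕ)] (sphere (0 : V) 1)).toReal *
      ∫ u, g (u.1 (e 0)) * ∫ y, h y ∂sectionMeasure (2 * m + 1 : ℕ) (u.1 (e 0)) ∂ρ := by
    intro g h hg hh
    have hae : AEStronglyMeasurable (fun x => g x * ∫ y, h y ∂sectionMeasure (2 * m + 1 : ℕ) x)
      (μH[(2 * (m + 1) + 1 : ℕ)].restrict (sphere (0 : V) 1)) :=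
      (hg.aemeasurable.mul (aemeasurable_restrict_of_measurable_subtype
        isClosed_sphere.measurableSet
        (measurable_integral_sectionMeasure hV hh))).aestronglyMeasurable
    rw [hσ] at hae ⊢
    rw [integral_smul_measure, integral_map (havg.measurable_apply _).aemeasurable
      (hae.mono_ac (Measure.absolutelyContinuous_smul hσpos.1.ne')), smul_eq_mul]
  rw [hsm w f hw hf, hsm f w hf hw,
    integral_unitary_mul_sectionMeasure hV ρ hf hw hfC hwD he₁ he₂ he₁₂,
    integral_unitary_mul_sectionMeasure hV ρ hw hf hwD hfC he₁ he₂ he₁₂,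
    integral_unitary_pair_eq ρ (fun a b => f a * w b) he₂ he₁ he₂₁ he₁ he₂ he₁₂]
  simp only [mul_comm]

end Duality

section RepresentingMeasure

open Module Measure
open scoped ENNReal Real

variable {V : Type*} [NormedAddCommGroup V] [InnerProductSpace ℂ V] [FiniteDimensional ℂ V]
  [CompleteSpace V] [MeasurableSpace V] [BorelSpace V] {m : ℕ}

omit [FiniteDimensional ℂ V] [MeasurableSpace V] [BorelSpace V] in
theorem exists_unitary_eq_smul {c : ℂ} (hc : ‖c‖ = 1) :
    ∃ u : unitary (V →L[ℂ] V), ∀ x, u.1 x = c • x := by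
  have h : star c * c = 1 := by
    rw [Complex.star_def, Complex.conj_mul', hc, Complex.ofReal_one, one_pow]
  refine ⟨⟨c • 1, ?_⟩, fun x => by simp⟩
  rw [Unitary.mem_iff, star_smul, star_one, smul_mul_smul_comm, smul_mul_smul_comm, mul_comm c, h,
    mul_one, one_smul]
  exact ⟨rfl, rfl⟩

omit [FiniteDimensional ℂ V] in
theorem measurePreserving_smul_sectionMeasure (d : ℝ) {c : ℂ} (hc : ‖c‖ = 1) (x : V) :
    MeasurePreserving (c • ·) (sectionMeasure d x) (sectionMeasure d x) := by
  obtain ⟨u, hu⟩ := exists_unitary_eq_smul (V := V) hc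
  have hc0 : c ≠ 0 := by rintro rfl; simp at hc
  have h := sectionMeasure_map d u x
  have hx : sectionMeasure d (c • x) = sectionMeasure d x := by
    rw [sectionMeasure, sectionMeasure, Submodule.span_singleton_smul_eq hc0.isUnit]
  rwa [hu, hx, funext hu] at h

omit [FiniteDimensional ℂ V] in
theorem measurePreserving_smul_restrict_sphere (d : ℝ) {c : ℂ} (hc : ‖c‖ = 1) :
    MeasurePreserving (c • · : V → V) (μH[d].restrict (sphere 0 1))
      (μH[d].restrict (sphere 0 1)) := by
  obtain ⟨u, hu⟩ := exists_unitary_eq_smul (V := V) hc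
  have h : MeasurePreserving (c • · : V → V) μH[d] μH[d] := by
    rw [← funext hu]
    exact (Unitary.linearIsometryEquiv u).toIsometryEquiv.measurePreserving_hausdorffMeasure d
  have hs : (c • · : V → V) ⁻¹' sphere 0 1 = sphere 0 1 := by
    ext x
    simp [norm_smul, hc]
  have := h.restrict_preimage (isClosed_sphere (x := (0 : V)) (ε := 1)).measurableSet
  rwa [hs] at this

theorem sectionMeasure_univ_eq (d : ℝ) {x y : V} (h : ‖x‖ = ‖y‖) :
    sectionMeasure d x Set.univ = sectionMeasure d y Set.univ := by
  obtain ⟨u, rfl⟩ := exists_unitary_map_eq_of_norm_eq h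
  have := (sectionMeasure_map d u x).measure_preimage MeasurableSet.univ.nullMeasurableSet
  rwa [Set.preimage_univ] at this

theorem exists_sectionMeasure_density (hV : finrank ℂ V = m + 2) (T : V ≃ₗ[ℝ] V) :
    ∃ w : V → ℝ, Measurable w ∧ (∀ x, 0 ≤ w x) ∧ (∃ D, ∀ x, ‖x‖ = 1 → ‖w x‖ ≤ D) ∧
      (∀ (θ : ℝ) x, w (Complex.exp (θ * Complex.I) • x) = w x) ∧
      ∃ a, 0 < a ∧ ∀ x, ‖x‖ = 1 → ∫ y, w y ∂sectionMeasure (2 * m + 1 : ℕ) x =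
        a * ∫ θ : ℝ, (‖T.symm (Complex.exp (θ * Complex.I) • x)‖ ^ 2)⁻¹ ∂uniformAngle := by
  obtain ⟨B, hB⟩ : ∃ B : V →ₗ[ℝ] V, ∀ a b, (inner ℂ (B a) b).re = (inner ℂ a (T b)).re := by
    let : InnerProductSpace ℝ V := InnerProductSpace.complexToReal
    have : FiniteDimensional ℝ V := FiniteDimensional.complexToReal V
    exact ⟨LinearMap.adjoint T.toLinearMap, (LinearMap.eq_adjoint_iff _ _).1 rfl⟩
  have hfr : FiniteDimensional ℝ V := FiniteDimensional.complexToReal V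
  have hBi := injective_of_re_inner_eq T B hB
  have hBc : Continuous B := B.continuous_of_finiteDimensional
  have : Nontrivial V := finrank_pos_iff.1 (by omega : 0 < finrank ℂ V)
  obtain ⟨e, he⟩ := exists_norm_eq V zero_le_one
  let w₀ : V → ℝ≥0∞ := fun y => ENNReal.ofReal ((‖B y‖ ^ (2 * (m + 1)))⁻¹)
  have hw₀ : Measurable w₀ := ((hBc.norm.pow _).measurable.inv).ennreal_ofReal
  have hjoint : Measurable fun p : V × ℝ => w₀ (Complex.exp (p.2 * Complex.I) • p.1) :=
    hw₀.comp (Continuous.measurable (by fun_prop))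
  let W : V → ℝ≥0∞ := fun y => ∫⁻ θ : ℝ, w₀ (Complex.exp (θ * Complex.I) • y) ∂uniformAngle
  have hW : Measurable W := hjoint.lintegral_prod_right'
  obtain ⟨D, hD⟩ : ∃ D, ∀ y, ‖y‖ = 1 → w₀ y ≤ ENNReal.ofReal D := by
    have : ProperSpace V := FiniteDimensional.proper ℂ V
    obtain ⟨D, hD⟩ := (isCompact_sphere (0 : V) 1).exists_bound_of_continuousOn
      (f := fun y => (‖B y‖ ^ (2 * (m + 1)))⁻¹) (ContinuousOn.inv₀ (by fun_prop) fun y hy => by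
        have : y ≠ 0 := by rintro rfl; simp at hy
        exact pow_ne_zero _ (norm_ne_zero_iff.2 ((map_ne_zero_iff B hBi).2 this)))
    exact ⟨D, fun y hy => ENNReal.ofReal_le_ofReal
      ((Real.le_norm_self _).trans (hD y (by simpa using hy)))⟩
  have hWD : ∀ y, ‖y‖ = 1 → W y ≤ ENNReal.ofReal D := fun y hy =>
    (lintegral_mono fun θ => hD _ (by
      rw [norm_smul, Complex.norm_exp_ofReal_mul_I, hy, one_mul])).trans (by simp)
  obtain ⟨hκ0, hκt⟩ := sectionMeasure_univ_pos_lt_top hV he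
  refine ⟨fun y => (W y).toReal, hW.ennreal_toReal, fun y => ENNReal.toReal_nonneg,
    ⟨(ENNReal.ofReal D).toReal, fun y hy => ?_⟩, fun α y => ?_,
    (sectionMeasure (2 * m + 1 : ℕ) e Set.univ).toReal * |LinearMap.det T.toLinearMap|⁻¹,
    ?_, fun x hx => ?_⟩
  · rw [Real.norm_of_nonneg ENNReal.toReal_nonneg]
    exact ENNReal.toReal_mono ENNReal.ofReal_ne_top (hWD y hy)
  · refine congrArg ENNReal.toReal ?_
    simp only [W]
    refine (lintegral_congr fun θ => ?_).trans (lintegral_uniformAngle_add_right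
      (F := fun θ : ℝ => w₀ (Complex.exp (θ * Complex.I) • y)) (fun θ => ?_) α)
    · rw [smul_smul, ← Complex.exp_add]
      push_cast
      rw [add_mul]
    · simp only
      congr 2
      push_cast
      rw [add_mul, Complex.exp_periodic]
  · exact mul_pos (ENNReal.toReal_pos hκ0.ne' hκt.ne)
      (inv_pos.2 (abs_pos.2 (LinearEquiv.isUnit_det' T).ne_zero))
  · have hfin : IsFiniteMeasure (sectionMeasure (2 * m + 1 : ℕ) x) :=
      ⟨(sectionMeasure_univ_pos_lt_top hV hx).2⟩
    have h1 : ∫⁻ y, W y ∂sectionMeasure (2 * m + 1 : ℕ) x =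
        ∫⁻ y, w₀ y ∂sectionMeasure (2 * m + 1 : ℕ) x := by
      rw [lintegral_lintegral_swap hjoint.aemeasurable]
      simp_rw [(measurePreserving_smul_sectionMeasure _
        (Complex.norm_exp_ofReal_mul_I _) x).lintegral_comp hw₀]
      simp
    rw [integral_toReal hW.aemeasurable, h1,
      lintegral_sectionMeasure_norm_adjoint_pow_inv hV T B hB hx,
      sectionMeasure_univ_eq _ (hx.trans he.symm), ENNReal.toReal_mul, ENNReal.toReal_mul,
      ENNReal.toReal_ofReal (by positivity), mul_assoc, integral_eq_lintegral_of_nonneg_ae]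
    · exact .of_forall fun θ => by positivity
    · have hT : Continuous T.symm := T.symm.toLinearMap.continuous_of_finiteDimensional
      exact (Measurable.inv (Continuous.measurable (by fun_prop))).aestronglyMeasurable
    · filter_upwards [ae_sectionMeasure (2 * m + 1 : ℕ) x] with y hy
      exact (hWD y hy.1).trans_lt ENNReal.ofReal_lt_top

theorem exists_measure_integral_eq_integral_sectionMeasure (hV : finrank ℂ V = m + 2)
    (T : V ≃ₗ[ℝ] V) :
    ∃ μ : Measure V, IsFiniteMeasure μ ∧ μ (sphere 0 1)ᶜ = 0 ∧
      (∀ θ : ℝ, μ.map (fun x => Complex.exp (θ * Complex.I) • x) = μ) ∧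
      ∀ f : V → ℝ, Continuous f →
        ∫ x in sphere (0 : V) 1,
            (∫ θ : ℝ, (‖T.symm (Complex.exp (θ * Complex.I) • x)‖ ^ 2)⁻¹ ∂uniformAngle) * f x
            ∂μH[(2 * (m + 1) + 1 : ℕ)] =
          ∫ x in sphere (0 : V) 1, ∫ y, f y ∂sectionMeasure (2 * m + 1 : ℕ) x ∂μ := by
  obtain ⟨w, hw, hw0, ⟨D, hD⟩, hwrot, a, ha, hwa⟩ := exists_sectionMeasure_density hV T
  let σ : Measure V := μH[(2 * (m + 1) + 1 : ℕ)].restrict (sphere 0 1)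
  have hσ : IsFiniteMeasure σ :=
    ⟨by rw [restrict_apply_univ]; exact (hausdorffMeasure_complex_sphere hV).2⟩
  have hae : ∀ᵐ x ∂σ, x ∈ sphere (0 : V) 1 := ae_restrict_mem isClosed_sphere.measurableSet
  let g : V → ℝ≥0∞ := fun x => ENNReal.ofReal (a⁻¹ * w x)
  have hg : Measurable g := (hw.const_mul _).ennreal_ofReal
  have hμs : σ.withDensity g (sphere 0 1)ᶜ = 0 := withDensity_absolutelyContinuous σ g hae
  refine ⟨σ.withDensity g, ?_, hμs, fun θ => ?_, fun f hf => ?_⟩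
  · refine isFiniteMeasure_withDensity_ofReal (HasFiniteIntegral.of_bounded (C := a⁻¹ * D) ?_)
    filter_upwards [hae] with x hx
    rw [norm_mul, Real.norm_of_nonneg (inv_nonneg.2 ha.le)]
    gcongr
    exact hD x (by simpa using hx)
  · have hp := measurePreserving_smul_restrict_sphere (V := V) (2 * (m + 1) + 1 : ℕ)
      (Complex.norm_exp_ofReal_mul_I θ)
    ext s hs
    rw [map_apply hp.measurable hs, withDensity_apply _ (hp.measurable hs),
      withDensity_apply _ hs, ← hp.setLIntegral_comp_preimage hs hg]
    simp only [g, hwrot]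
    rfl
  · have : ProperSpace V := FiniteDimensional.proper ℂ V
    obtain ⟨C, hC⟩ := (isCompact_sphere (0 : V) 1).exists_bound_of_continuousOn hf.continuousOn
    have hcomm := integral_sphere_mul_sectionMeasure_comm hV hf.measurable hw
      (fun x hx => hC x (by simpa using hx)) hD
    have hres : (σ.withDensity g).restrict (sphere 0 1) = σ.withDensity g :=
      restrict_eq_self_of_ae_mem hμs
    rw [hres, integral_withDensity_eq_integral_toReal_smul hg
        (.of_forall fun x => ENNReal.ofReal_lt_top)]
    have h1 : ∀ x, (g x).toReal • ∫ y, f y ∂sectionMeasure (2 * m + 1 : ℕ) x =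
        a⁻¹ * (w x * ∫ y, f y ∂sectionMeasure (2 * m + 1 : ℕ) x) := fun x => by
      rw [ENNReal.toReal_ofReal (mul_nonneg (inv_nonneg.2 ha.le) (hw0 x)), smul_eq_mul, mul_assoc]
    simp_rw [h1]
    rw [integral_const_mul, hcomm, ← integral_const_mul]
    refine setIntegral_congr_fun isClosed_sphere.measurableSet fun x hx => ?_
    rw [hwa x (by simpa using hx), mul_left_comm, inv_mul_cancel_left₀ ha.ne', mul_comm]

end RepresentingMeasure

section GaugeStarBody

theorem gauge_image_linearEquiv {E F : Type*} [AddCommGroup E] [Module ℝ E] [AddCommGroup F]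
    [Module ℝ F] (T : E ≃ₗ[ℝ] F) (s : Set E) (x : F) :
    gauge (T '' s) x = gauge s (T.symm x) := by
  simp only [gauge_def', T.image_eq_preimage_symm, Set.mem_preimage, map_smul]

variable {V : Type*} [NormedAddCommGroup V] [NormedSpace ℝ V] [FiniteDimensional ℝ V]

theorem exists_mul_norm_le_le_mul_norm {p : V → ℝ}
    (hsmul : ∀ r : ℝ, 0 ≤ r → ∀ x, p (r • x) = r * p x) (hpos : ∀ x, x ≠ 0 → 0 < p x)
    (hc : ContinuousOn p {0}ᶜ) :
    ∃ a b : ℝ, 0 < a ∧ ∀ x, a * ‖x‖ ≤ p x ∧ p x ≤ b * ‖x‖ := by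
  have hp0 : p 0 = 0 := by simpa using hsmul 0 le_rfl 0
  have hne : ∀ x ∈ sphere (0 : V) 1, x ≠ 0 := by
    rintro x hx rfl
    simp at hx
  have hcs : ContinuousOn p (sphere 0 1) := hc.mono hne
  have : ProperSpace V := FiniteDimensional.proper ℝ V
  obtain ⟨b, hb⟩ := (isCompact_sphere (0 : V) 1).exists_bound_of_continuousOn hcs
  obtain ⟨a, ha, hab⟩ : ∃ a : ℝ, 0 < a ∧ ∀ x ∈ sphere (0 : V) 1, a ≤ p x :=
    (isCompact_sphere (0 : V) 1).exists_forall_le' hcs fun x hx => hpos x (hne x hx)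
  refine ⟨a, b, ha, fun x => ?_⟩
  rcases eq_or_ne x 0 with rfl | hx
  · simp [hp0]
  have hs : ‖x‖⁻¹ • x ∈ sphere (0 : V) 1 := by simp [norm_smul, hx]
  have hpx : p x = ‖x‖ * p (‖x‖⁻¹ • x) := by
    rw [← hsmul _ (norm_nonneg x), smul_inv_smul₀ (norm_ne_zero_iff.2 hx)]
  rw [hpx, mul_comm a, mul_comm b]
  exact ⟨by gcongr; exact hab _ hs,
    by gcongr; exact (Real.le_norm_self _).trans (hb _ hs)⟩

theorem isStarBody_of_gauge {K : Set V} (hK : K = {x | gauge K x ≤ 1})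
    (hpos : ∀ x, x ≠ 0 → 0 < gauge K x) (hc : ContinuousOn (gauge K) {0}ᶜ) : IsStarBody K := by
  have hsmul : ∀ r : ℝ, 0 ≤ r → ∀ x, gauge K (r • x) = r * gauge K x := fun r hr x => by
    rw [gauge_smul_of_nonneg hr, smul_eq_mul]
  obtain ⟨a, b, ha, hab⟩ := exists_mul_norm_le_le_mul_norm hsmul hpos hc
  have : ProperSpace V := FiniteDimensional.proper ℝ V
  have hcont : Continuous (gauge K) := by
    refine continuous_iff_continuousAt.2 fun x => ?_
    rcases eq_or_ne x 0 with rfl | hx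
    · rw [ContinuousAt, gauge_zero]
      refine squeeze_zero (fun x => gauge_nonneg x) (fun x => (hab x).2) ?_
      exact Continuous.tendsto' (by fun_prop) _ _ (by simp)
    · exact hc.continuousAt (isOpen_compl_singleton.mem_nhds hx)
  have hclosed : IsClosed K := by
    rw [hK]
    exact isClosed_le hcont continuous_const
  have hsub : {x | gauge K x < 1} ⊆ interior K :=
    interior_maximal (fun x (hx : gauge K x < 1) => by
      rw [hK]; exact hx.le) (isOpen_lt hcont continuous_const)
  have hfr : ∀ x, x ∈ frontier K ↔ gauge K x = 1 := fun x => by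
    rw [hclosed.frontier_eq]
    constructor
    · rintro ⟨hx, hxi⟩
      rw [hK] at hx
      exact le_antisymm hx (not_lt.1 fun h => hxi (hsub h))
    · intro hx
      refine ⟨by rw [hK]; exact hx.le, fun hxi => ?_⟩
      have ht : Filter.Tendsto (fun t : ℝ => t • x) (nhdsWithin 1 (Set.Ioi 1)) (nhds x) :=
        (Continuous.tendsto' (f := fun t : ℝ => t • x) (by fun_prop) _ _
          (one_smul ℝ x)).mono_left nhdsWithin_le_nhds
      obtain ⟨t, htK, ht1⟩ := ((ht.eventually (mem_interior_iff_mem_nhds.1 hxi)).and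
        self_mem_nhdsWithin).exists
      have ht1 : 1 < t := ht1
      have htK : t • x ∈ K := htK
      rw [hK, Set.mem_ofPred_eq, hsmul t (by linarith), hx] at htK
      linarith
  refine ⟨isCompact_of_isClosed_isBounded hclosed ?_, hsub (by simp), fun x hx => ?_, hcont⟩
  · refine (isBounded_iff_forall_norm_le).2 ⟨a⁻¹, fun x hx => ?_⟩
    rw [hK] at hx
    rw [← one_div, le_div_iff₀' ha]
    exact (hab x).1.trans hx
  · have hx' := hpos x hx
    refine ⟨(gauge K x)⁻¹, ⟨inv_pos.2 hx', (hfr _).2 ?_⟩, ?_⟩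
    · rw [hsmul _ (inv_pos.2 hx').le, inv_mul_cancel₀ hx'.ne']
    · rintro t ⟨ht, htK⟩
      rw [hfr, hsmul t ht.le] at htK
      exact eq_inv_of_mul_eq_one_left htK

end GaugeStarBody

section AngularAverage

variable {V : Type*} [NormedAddCommGroup V] [NormedSpace ℂ V] [FiniteDimensional ℝ V]

theorem continuousOn_norm_rotate_sq_inv (L : V ≃ₗ[ℝ] V) :
    ContinuousOn (fun p : V × ℝ => (‖L (Complex.exp (p.2 * Complex.I) • p.1)‖ ^ 2)⁻¹)
      ({0}ᶜ ×ˢ Set.univ) := by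
  have hL : Continuous L := L.toLinearMap.continuous_of_finiteDimensional
  refine ContinuousOn.inv₀ (Continuous.continuousOn (by fun_prop)) fun p hp => ?_
  exact pow_ne_zero _ (norm_ne_zero_iff.2 (L.map_ne_zero_iff.2
    (smul_ne_zero (Complex.exp_ne_zero _) hp.1)))

theorem continuousOn_angularAverage (L : V ≃ₗ[ℝ] V) :
    ContinuousOn (fun x => 1 / (2 * Real.pi) * ∫ θ in (0 : ℝ)..(2 * Real.pi),
      (‖L (Complex.exp (θ * Complex.I) • x)‖ ^ 2)⁻¹) {0}ᶜ := by
  rw [continuousOn_iff_continuous_domRestrict]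
  refine continuous_const.mul
    (intervalIntegral.continuous_parametric_intervalIntegral_of_continuous'
      (f := fun (x : ({0}ᶜ : Set V)) θ => (‖L (Complex.exp (θ * Complex.I) • x.1)‖ ^ 2)⁻¹) ?_ _ _)
  exact (continuousOn_norm_rotate_sq_inv L).comp_continuous
    (f := fun p : ({0}ᶜ : Set V) × ℝ => (p.1.1, p.2)) (by fun_prop)
    fun p => ⟨p.1.2, Set.mem_univ _⟩

theorem angularAverage_pos (L : V ≃ₗ[ℝ] V) {x : V} (hx : x ≠ 0) :
    0 < 1 / (2 * Real.pi) * ∫ θ in (0 : ℝ)..(2 * Real.pi),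
      (‖L (Complex.exp (θ * Complex.I) • x)‖ ^ 2)⁻¹ := by
  have hc : Continuous fun θ : ℝ => (‖L (Complex.exp (θ * Complex.I) • x)‖ ^ 2)⁻¹ :=
    (continuousOn_norm_rotate_sq_inv L).comp_continuous (f := fun θ : ℝ => (x, θ)) (by fun_prop)
      fun θ => ⟨hx, Set.mem_univ _⟩
  refine mul_pos (by positivity) (intervalIntegral.intervalIntegral_pos_of_pos
    (hc.intervalIntegrable _ _) (fun θ => ?_) Real.two_pi_pos)
  have : L (Complex.exp (θ * Complex.I) • x) ≠ 0 :=
    L.map_ne_zero_iff.2 (smul_ne_zero (Complex.exp_ne_zero _) hx)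
  positivity

omit [FiniteDimensional ℝ V] in
theorem intervalIntegral_rotate_smul (F : V → ℝ) (α : ℝ) (x : V) :
    ∫ θ in (0 : ℝ)..(2 * Real.pi),
        F (Complex.exp (θ * Complex.I) • Complex.exp (α * Complex.I) • x) =
      ∫ θ in (0 : ℝ)..(2 * Real.pi), F (Complex.exp (θ * Complex.I) • x) := by
  have hp : Function.Periodic (fun θ : ℝ => F (Complex.exp (θ * Complex.I) • x))
      (2 * Real.pi) := fun θ => by
    simp only
    congr 2
    push_cast
    rw [add_mul, Complex.exp_periodic]
  have h := intervalIntegral.integral_comp_add_right (a := 0) (b := 2 * Real.pi)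
    (fun θ : ℝ => F (Complex.exp (θ * Complex.I) • x)) α
  rw [zero_add, add_comm _ α, hp.intervalIntegral_add_eq α 0, zero_add] at h
  rw [← h]
  refine intervalIntegral.integral_congr fun θ _ => ?_
  rw [smul_smul, ← Complex.exp_add]
  push_cast
  rw [add_mul]

end AngularAverage

/-- if `K = T(B_2^{2n})` is an origin-symmetric ellipsoid in `ℝ^{2n} ≅ ℂ^n` and
the star body `K_c` is defined by `‖x‖_{K_c}^{−2} = (1/(2π)) ∫_0^{2π} ‖R_θ x‖_K^{−2} dθ`,
then `K_c` is a complex intersection body. -/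
theorem rotation_average_of_ellipsoid_is_complex_intersection_body
    (n : ℕ) (hn : 2 ≤ n)
    (T : EuclideanSpace ℂ (Fin n) ≃ₗ[ℝ] EuclideanSpace ℂ (Fin n))
    (K : Set (EuclideanSpace ℂ (Fin n)))
    (hK : K = T '' closedBall (0 : EuclideanSpace ℂ (Fin n)) 1)
    (Kc : Set (EuclideanSpace ℂ (Fin n)))
    (hKcdef : Kc = {x : EuclideanSpace ℂ (Fin n) | gauge Kc x ≤ 1})
    (hKcgauge : ∀ x : EuclideanSpace ℂ (Fin n), x ≠ 0 →
      ((gauge Kc x) ^ 2)⁻¹ =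
        (1 / (2 * Real.pi)) * ∫ θ in (0 : ℝ)..(2 * Real.pi), ((gauge K (rot θ x)) ^ 2)⁻¹) :
    IsComplexIntersectionBody Kc := by
  have hfd : FiniteDimensional ℝ (EuclideanSpace ℂ (Fin n)) := FiniteDimensional.complexToReal _
  have hgK : ∀ x, gauge K x = ‖T.symm x‖ := fun x => by
    rw [hK, gauge_image_linearEquiv, gauge_closedBall zero_le_one, div_one]
  simp only [hgK, rot] at hKcgauge
  have hpos : ∀ x, x ≠ 0 → 0 < gauge Kc x := fun x hx => by
    refine (gauge_nonneg x).lt_of_ne' fun h => ?_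
    have := angularAverage_pos T.symm hx
    rw [← hKcgauge x hx, h] at this
    simp at this
  have hcont : ContinuousOn (gauge Kc) {0}ᶜ := by
    refine ((continuousOn_angularAverage T.symm).inv₀
      fun x hx => (angularAverage_pos T.symm hx).ne').sqrt.congr fun x hx => ?_
    simp only [Pi.inv_apply]
    rw [← hKcgauge x hx, inv_inv, Real.sqrt_sq (gauge_nonneg x)]
  have hrot : ∀ (α : ℝ) x, gauge Kc (rot α x) = gauge Kc x := fun α x => by
    rcases eq_or_ne x 0 with rfl | hx
    · simp [rot]
    have hx' : rot α x ≠ 0 := smul_ne_zero (Complex.exp_ne_zero _) hx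
    refine (sq_eq_sq₀ (gauge_nonneg _) (gauge_nonneg _)).1 (inv_injective ?_)
    rw [hKcgauge _ hx', hKcgauge x hx]
    exact congrArg _ (intervalIntegral_rotate_smul (fun y => (‖T.symm y‖ ^ 2)⁻¹) α x)
  have hmem : ∀ x, x ∈ Kc ↔ gauge Kc x ≤ 1 := fun x =>
    ⟨fun h => by rwa [hKcdef] at h, fun h => by rwa [hKcdef]⟩
  refine ⟨isStarBody_of_gauge hKcdef hpos hcont, ?_, fun θ => ?_, ?_⟩
  · ext x
    have h := hrot Real.pi x
    rw [rot, Complex.exp_pi_mul_I, neg_one_smul] at h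
    rw [Set.mem_neg, hmem, hmem, h]
  · ext x
    constructor
    · rintro ⟨y, hy, rfl⟩
      rwa [hmem, hrot, ← hmem]
    · intro hx
      refine ⟨rot (-θ) x, by rwa [hmem, hrot, ← hmem], ?_⟩
      rw [rot, rot, smul_smul, ← Complex.exp_add, ← add_mul, ← Complex.ofReal_add,
        add_neg_cancel, Complex.ofReal_zero, zero_mul, Complex.exp_zero, one_smul]
  · obtain ⟨m, rfl⟩ := Nat.exists_eq_add_of_le' hn
    obtain ⟨μ, hμ, hμs, hμr, hμf⟩ :=
      exists_measure_integral_eq_integral_sectionMeasure (finrank_euclideanSpace_fin (𝕜 := ℂ)) T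
    refine ⟨μ, hμ, hμs, hμr, fun f hf _ => ?_⟩
    have h1 : 2 * ((m + 2 : ℕ) : ℝ) - 1 = ((2 * (m + 1) + 1 : ℕ) : ℝ) := by push_cast; ring
    have h3 : 2 * ((m + 2 : ℕ) : ℝ) - 3 = ((2 * m + 1 : ℕ) : ℝ) := by push_cast; ring
    rw [h1, h3]
    refine Eq.trans (setIntegral_congr_fun isClosed_sphere.measurableSet fun x hx => ?_) (hμf f hf)
    have hx0 : x ≠ 0 := by
      rintro rfl
      simp at hx
    rw [hKcgauge x hx0, integral_uniformAngle]
end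
end

section
/- Let K be a star body in ℝ^{2n}, let L be an R_θ-invariant set, and suppose (1/√(2n))·K ⊆ L ⊆ K. Define the star body K_c by ‖x‖_{K_c}^{−2} = (1/(2π)) ∫_0^{2π} ‖R_θ x‖_K^{−2} dθ. Then (1/√(2n))·K_c ⊆ L ⊆ K_c. -/
open MeasureTheory Metric Pointwise

noncomputable section

variable {n : ℕ}

/-- A preconnected set that meets both a set and its complement meets the frontier of that set. -/
theorem IsPreconnected.inter_frontier_nonempty {X : Type*} [TopologicalSpace X] {T s : Set X}
    (hT : IsPreconnected T) (hs : (T ∩ s).Nonempty) (hsc : (T ∩ sᶜ).Nonempty) :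
    (T ∩ frontier s).Nonempty := by
  by_contra hne
  have hfr : ∀ x ∈ T, x ∈ closure s → x ∈ interior s := fun x hxT hxs =>
    by_contra fun hxi => hne ⟨x, hxT, hxs, hxi⟩
  obtain ⟨a, haT, has⟩ := hs
  obtain ⟨b, hbT, hbs⟩ := hsc
  obtain ⟨x, -, hxi, hxc⟩ := hT (interior s) (closure s)ᶜ isOpen_interior
    isClosed_closure.isOpen_compl
    (fun x hxT => or_iff_not_imp_right.2 fun h => hfr x hxT (Set.notMem_compl_iff.1 h))
    ⟨a, haT, hfr a haT (subset_closure has)⟩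
    ⟨b, hbT, fun h => hbs (interior_subset (hfr b hbT h))⟩
  exact hxc (subset_closure (interior_subset hxi))

/-- A point of gauge less than `1` belongs to the star body. -/
theorem IsStarBody.mem_of_gauge_lt_one {V : Type*} [NormedAddCommGroup V] [NormedSpace ℝ V]
    {K : Set V} (hK : IsStarBody K) {y : V} (hy : gauge K y < 1) : y ∈ K := by
  obtain ⟨hcomp, h0, hray, -⟩ := hK
  by_contra hyK
  have hy0 : y ≠ 0 := fun h => hyK (h ▸ interior_subset h0)
  obtain ⟨b, hb0, hb1, hyb⟩ := exists_lt_of_gauge_lt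
    (absorbent_nhds_zero (mem_interior_iff_mem_nhds.1 h0)) hy
  have hybK : b⁻¹ • y ∈ K := (Set.mem_smul_set_iff_inv_smul_mem₀ hb0.ne' K y).1 hyb
  have hcont : Continuous fun t : ℝ => t • y := by fun_prop
  obtain ⟨_, ⟨t, ht, rfl⟩, htK⟩ :=
    ((isPreconnected_Icc (a := (0 : ℝ)) (b := 1)).image _ hcont.continuousOn).inter_frontier_nonempty
      (s := K) ⟨_, ⟨0, by simp, rfl⟩, by simpa using interior_subset h0⟩
      ⟨_, ⟨1, by simp, rfl⟩, by simpa using hyK⟩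
  obtain ⟨R, hR⟩ := hcomp.isBounded.exists_norm_le
  have hny : 0 < ‖y‖ := norm_pos_iff.2 hy0
  obtain ⟨_, ⟨u, hu, rfl⟩, huK⟩ :=
    ((isPreconnected_Ici (a := b⁻¹)).image _ hcont.continuousOn).inter_frontier_nonempty
      (s := K) ⟨_, ⟨b⁻¹, by simp, rfl⟩, hybK⟩
      ⟨_, ⟨max b⁻¹ ((R + 1) / ‖y‖), Set.mem_Ici.2 (le_max_left _ _), rfl⟩, fun hmem => by
        have h1 := hR _ hmem
        rw [norm_smul, Real.norm_eq_abs] at h1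
        have h2 := (le_max_right b⁻¹ ((R + 1) / ‖y‖)).trans (le_abs_self _)
        rw [div_le_iff₀ hny] at h2
        linarith⟩
  have hb : 1 < b⁻¹ := (one_lt_inv₀ hb0).2 hb1
  have hu' : b⁻¹ ≤ u := hu
  have ht0 : 0 < t := by
    refine lt_of_le_of_ne ht.1 fun h => ?_
    simp only [← h, zero_smul] at htK
    exact htK.2 h0
  have := (hray y hy0).unique ⟨ht0, htK⟩ ⟨by linarith, huK⟩
  linarith [ht.2]

/-- A star body contains the closed unit ball of its gauge. -/
theorem IsStarBody.mem_of_gauge_le_one {V : Type*} [NormedAddCommGroup V] [NormedSpace ℝ V]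
    {K : Set V} (hK : IsStarBody K) {y : V} (hy : gauge K y ≤ 1) : y ∈ K := by
  have hcont : Continuous fun t : ℝ => t • y := by fun_prop
  have hmem : (1 : ℝ) ∈ closure (Set.Ico (0 : ℝ) 1) := by
    rw [closure_Ico zero_ne_one]; simp
  have := map_mem_closure hcont hmem (t := K) fun t ht => hK.mem_of_gauge_lt_one <| by
    rw [gauge_smul_of_nonneg ht.1, smul_eq_mul]
    nlinarith [ht.1, ht.2, gauge_nonneg (s := K) y]
  rwa [hK.1.isClosed.closure_eq, one_smul] at this

theorem IsStarBody.gauge_pos {V : Type*} [NormedAddCommGroup V] [NormedSpace ℝ V]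
    {K : Set V} (hK : IsStarBody K) {y : V} (hy : y ≠ 0) : 0 < gauge K y :=
  (_root_.gauge_pos (absorbent_nhds_zero (mem_interior_iff_mem_nhds.1 hK.2.1))
    ((NormedSpace.isVonNBounded_iff ℝ).2 hK.1.isBounded)).2 hy

theorem rot_ne_zero {x : EuclideanSpace ℂ (Fin n)} (hx : x ≠ 0) (θ : ℝ) : rot θ x ≠ 0 :=
  smul_ne_zero (Complex.exp_ne_zero _) hx

theorem continuous_rot (x : EuclideanSpace ℂ (Fin n)) : Continuous fun θ : ℝ => rot θ x := by
  unfold rot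
  fun_prop

theorem rot_neg_rot (θ : ℝ) (x : EuclideanSpace ℂ (Fin n)) : rot (-θ) (rot θ x) = x := by
  simp [rot, smul_smul, ← Complex.exp_add]

theorem rot_smul (θ c : ℝ) (x : EuclideanSpace ℂ (Fin n)) : rot θ (c • x) = c • rot θ x :=
  smul_comm _ _ _

theorem RotInvariantSet.rot_mem {A : Set (EuclideanSpace ℂ (Fin n))} (hA : RotInvariantSet A)
    (θ : ℝ) {x : EuclideanSpace ℂ (Fin n)} (hx : x ∈ A) : rot θ x ∈ A :=
  hA θ ▸ Set.mem_image_of_mem _ hx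

theorem IsStarBody.continuous_inv_sq_gauge_rot {K : Set (EuclideanSpace ℂ (Fin n))}
    (hK : IsStarBody K) {x : EuclideanSpace ℂ (Fin n)} (hx : x ≠ 0) :
    Continuous fun θ : ℝ => ((gauge K (rot θ x)) ^ 2)⁻¹ :=
  ((hK.2.2.2.comp (continuous_rot x)).pow 2).inv₀ fun θ =>
    (pow_pos (hK.gauge_pos (rot_ne_zero hx θ)) 2).ne'

/-- if `K` is a star body in `ℝ^{2n} ≅ ℂ^n`, `L` is an `R_θ`-invariant set with
`(1/√(2n))·K ⊆ L ⊆ K`, and `K_c` is the star body defined by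
`‖x‖_{K_c}^{−2} = (1/(2π)) ∫_0^{2π} ‖R_θ x‖_K^{−2} dθ`, then `(1/√(2n))·K_c ⊆ L ⊆ K_c`. -/
theorem rotation_average_body_sandwich
    (n : ℕ)
    (K : Set (EuclideanSpace ℂ (Fin n))) (hK : IsStarBody K)
    (L : Set (EuclideanSpace ℂ (Fin n))) (hLinv : RotInvariantSet L)
    (hKL : (Real.sqrt (2 * n))⁻¹ • K ⊆ L) (hLK : L ⊆ K)
    (Kc : Set (EuclideanSpace ℂ (Fin n))) (hKc : IsStarBody Kc)
    (hKcdef : Kc = {x : EuclideanSpace ℂ (Fin n) | gauge Kc x ≤ 1})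
    (hKcgauge : ∀ x : EuclideanSpace ℂ (Fin n), x ≠ 0 →
      ((gauge Kc x) ^ 2)⁻¹ =
        (1 / (2 * Real.pi)) * ∫ θ in (0 : ℝ)..(2 * Real.pi), ((gauge K (rot θ x)) ^ 2)⁻¹) :
    (Real.sqrt (2 * n))⁻¹ • Kc ⊆ L ∧ L ⊆ Kc := by
  have hpi : 0 < 2 * Real.pi := Real.two_pi_pos
  constructor
  · rintro _ ⟨x, hx, rfl⟩
    rcases eq_or_ne x 0 with rfl | hx0
    · exact hKL ⟨0, interior_subset hK.2.1, rfl⟩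
    suffices h : ∃ θ : ℝ, gauge K (rot θ x) ≤ 1 by
      obtain ⟨θ, hθ⟩ := h
      have hmem := hLinv.rot_mem (-θ) (hKL (Set.smul_mem_smul_set (hK.mem_of_gauge_le_one hθ)))
      rwa [rot_smul, rot_neg_rot] at hmem
    by_contra! hgt
    have hlt : ∀ θ : ℝ, ((gauge K (rot θ x)) ^ 2)⁻¹ < 1 := fun θ =>
      inv_lt_one_of_one_lt₀ (one_lt_pow₀ (hgt θ) two_ne_zero)
    have hcmp : ∫ θ in (0 : ℝ)..(2 * Real.pi), ((gauge K (rot θ x)) ^ 2)⁻¹ <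
        ∫ _ in (0 : ℝ)..(2 * Real.pi), (1 : ℝ) :=
      intervalIntegral.integral_lt_integral_of_continuousOn_of_le_of_exists_lt hpi
        (hK.continuous_inv_sq_gauge_rot hx0).continuousOn continuousOn_const
        (fun θ _ => (hlt θ).le) ⟨0, ⟨le_rfl, hpi.le⟩, hlt 0⟩
    rw [intervalIntegral.integral_const, sub_zero, smul_eq_mul, mul_one] at hcmp
    have hle : gauge Kc x ≤ 1 := by rw [hKcdef] at hx; exact hx
    have hone : 1 ≤ ((gauge Kc x) ^ 2)⁻¹ :=
      (one_le_inv₀ (pow_pos (hKc.gauge_pos hx0) 2)).2 (pow_le_one₀ (gauge_nonneg x) hle)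
    rw [hKcgauge x hx0, one_div, ← div_eq_inv_mul, le_div_iff₀ hpi] at hone
    linarith
  · intro x hx
    rcases eq_or_ne x 0 with rfl | hx0
    · exact interior_subset hKc.2.1
    have hge : ∀ θ : ℝ, 1 ≤ ((gauge K (rot θ x)) ^ 2)⁻¹ := fun θ =>
      (one_le_inv₀ (pow_pos (hK.gauge_pos (rot_ne_zero hx0 θ)) 2)).2
        (pow_le_one₀ (gauge_nonneg _) (gauge_le_one_of_mem (hLK (hLinv.rot_mem θ hx))))
    have hcmp : ∫ _ in (0 : ℝ)..(2 * Real.pi), (1 : ℝ) ≤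
        ∫ θ in (0 : ℝ)..(2 * Real.pi), ((gauge K (rot θ x)) ^ 2)⁻¹ :=
      intervalIntegral.integral_mono_on hpi.le (by simp)
        ((hK.continuous_inv_sq_gauge_rot hx0).intervalIntegrable _ _) fun θ _ => hge θ
    rw [intervalIntegral.integral_const, sub_zero, smul_eq_mul, mul_one] at hcmp
    have hone : 1 ≤ ((gauge Kc x) ^ 2)⁻¹ := by
      rw [hKcgauge x hx0, one_div, ← div_eq_inv_mul, le_div_iff₀ hpi]
      linarith
    rw [one_le_inv₀ (pow_pos (hKc.gauge_pos hx0) 2)] at hone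
    exact hKc.mem_of_gauge_le_one ((pow_le_one_iff_of_nonneg (gauge_nonneg x) two_ne_zero).1 hone)
end
end
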